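/- arXiv:2207.14523 — 4 statements merged into one kernel-verified Lean document; each statement's English description precedes it below -/
import Mathlib

section
/- Let K be an algebraically closed field and let f ∈ K[[x,y]] be irreducible with semigroup of values Γ(f) = ⟨v₀, v₁, …, v_h⟩ (minimal system of generators v₀ < v₁ < ⋯ < v_h with gcd(v₀,…,v_h) = 1). If c is the conductor of Γ(f), then c ≥ (v₀−1)(v₁−1) + gcd(v₀,v₁) − 1, and the equality c = (v₀−1)(v₁−1) holds if and only if gcd(v₀,v₁) = 1. -/
/-!
Common definitions for formalizing "A note on the plane curve singularities in
positive characteristic" by E. García Barroso and A. Płoski.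

We work with the ring `K[[x,y]] := MvPowerSeries (Fin 2) K`, where `x` is the
variable of index `0` and `y` the variable of index `1`.
-/

open scoped Classical

noncomputable section

universe u

namespace PlaneCurveNote

/-- The formal power series ring `K[[x,y]]`. -/
abbrev PS (K : Type u) [Field K] := MvPowerSeries (Fin 2) K

variable (K : Type u) [Field K]

/-- The variable `x`. -/
def Xv : PS K := MvPowerSeries.X 0

/-- The variable `y`. -/
def Yv : PS K := MvPowerSeries.X 1

/-- The coefficient `c_{αβ}` of `x^α y^β` in `f`. -/
def coef (f : PS K) (p : ℕ × ℕ) : K :=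
  MvPowerSeries.coeff (Finsupp.single 0 p.1 + Finsupp.single 1 p.2) f

/-- The support of a power series, as a subset of `ℕ²`. -/
def supp (f : PS K) : Set (ℕ × ℕ) := {p | coef K f p ≠ 0}

/-- Build a power series from a coefficient function on `ℕ²`. -/
def ofCoef (c : ℕ × ℕ → K) : PS K := fun d => c (d 0, d 1)

/-- A reduced power series: nonzero, without constant term and without multiple factors. -/
def IsReducedSeries (f : PS K) : Prop :=
  f ≠ 0 ∧ MvPowerSeries.constantCoeff f = 0 ∧ Squarefree f

/-- `r(f)`: the number of irreducible factors of `f` (counted up to associates,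
i.e. the number of distinct irreducible components of the curve `f = 0` when `f` is reduced). -/
def numFactors (f : PS K) : ℕ :=
  Set.ncard {P : Associates (PS K) | Irreducible P ∧ P ∣ Associates.mk f}

/-- The local ring `O_f = K[[x,y]]/(f)` of the curve `f = 0`. -/
abbrev CurveRing (f : PS K) := PS K ⧸ Ideal.span ({f} : Set (PS K))

/-- `deltaSpec K f d` expresses that `d = δ(f) = dim_K Ō_f/O_f`, where `Ō_f` is the integral
closure of `O_f = K[[x,y]]/(f)` in (any model `L` of) its total ring of fractions. -/
def deltaSpec (f : PS K) (d : ℕ) : Prop :=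
  ∀ (L : Type u) [CommRing L] [Algebra K L] [Algebra (CurveRing K f) L]
    [IsScalarTower K (CurveRing K f) L] [IsFractionRing (CurveRing K f) L],
    letI N : Submodule K L := Submodule.span K ((integralClosure (CurveRing K f) L : Set L))
    letI P : Submodule K L := Submodule.span K (Set.range (algebraMap (CurveRing K f) L))
    d = Module.finrank K (↥N ⧸ (P.comap N.subtype))

/-- `δ(f)`, the delta invariant of `f`. -/
def delta (f : PS K) : ℕ := sInf {d | deltaSpec K f d}

/-- `μ̄(f) = 2δ(f) - r(f) + 1`, the invariant Milnor number of `f`. -/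
def muBar (f : PS K) : ℤ := 2 * (delta K f : ℤ) - (numFactors K f : ℤ) + 1

/-- `i₀(f,g) = dim_K K[[x,y]]/(f,g)`, the intersection multiplicity of `f` and `g`
(as a natural number; meaningful when it is finite). -/
def iMult (f g : PS K) : ℕ :=
  Module.finrank K (PS K ⧸ Ideal.span ({f, g} : Set (PS K)))

/-- `i₀(f,g)` as a cardinal (`dim_K K[[x,y]]/(f,g)`), allowing the infinite case. -/
def iMultC (f g : PS K) : Cardinal :=
  Module.rank K (PS K ⧸ Ideal.span ({f, g} : Set (PS K)))

/-- `Γ(f)`: the semigroup of values of an irreducible `f`, i.e. the set of intersection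
multiplicities `i₀(f,g)` where `g` runs over power series with `g ≢ 0 (mod f)`. -/
def valueSemigroup (f : PS K) : Set ℕ :=
  {n | ∃ g : PS K, ¬ f ∣ g ∧ n = iMult K f g}

/-- `ord f`, the order of a power series. -/
def ordSeries (f : PS K) : ℕ := sInf ((fun p => p.1 + p.2) '' supp K f)

/-- `m = ord f(x,0)`. -/
def ordX (f : PS K) : ℕ := sInf {a : ℕ | (a, 0) ∈ supp K f}

/-- `n = ord f(0,y)`. -/
def ordY (f : PS K) : ℕ := sInf {b : ℕ | (0, b) ∈ supp K f}

/-- `f` is convenient if `f(x,0) f(0,y) ≠ 0`. -/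
def Convenient (f : PS K) : Prop :=
  (∃ a : ℕ, (a, 0) ∈ supp K f) ∧ (∃ b : ℕ, (0, b) ∈ supp K f)

/-- A Newton edge: a segment with vertices `(α,β)`, `(α',β') ∈ ℕ²`, `α < α'`, `β' < β`. -/
structure NEdge : Type where
  A : ℕ × ℕ
  B : ℕ × ℕ
  hx : A.1 < B.1
  hy : B.2 < A.2

/-- `|S|₁ = α' - α`. -/
def NEdge.len1 (S : NEdge) : ℕ := S.B.1 - S.A.1

/-- `|S|₂ = β - β'`. -/
def NEdge.len2 (S : NEdge) : ℕ := S.A.2 - S.B.2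

/-- `r(S) = gcd(|S|₁, |S|₂)`. -/
def NEdge.rE (S : NEdge) : ℕ := Nat.gcd S.len1 S.len2

/-- The lattice points lying on the segment `S`. -/
def NEdge.mem (S : NEdge) (p : ℕ × ℕ) : Prop :=
  S.A.1 ≤ p.1 ∧ p.1 ≤ S.B.1 ∧ S.B.2 ≤ p.2 ∧ p.2 ≤ S.A.2 ∧
    (p.1 - S.A.1) * S.len2 = (S.A.2 - p.2) * S.len1

/-- `[S,T] = min{|S|₁|T|₂, |S|₂|T|₁}`. -/
def bracket (S T : NEdge) : ℕ := min (S.len1 * T.len2) (S.len2 * T.len1)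

/-- The Newton polygon `N_f` of `f`, described as the set of compact edges of the boundary of
the Newton diagram of `f`: an edge belongs to `N_f` iff its endpoints lie in the support of `f`
and some weight vector `w` with positive entries attains its minimum on the support of `f`
exactly on this segment. -/
def newtonPolygon (f : PS K) : Set NEdge :=
  {S | S.A ∈ supp K f ∧ S.B ∈ supp K f ∧
    ∃ w : ℕ × ℕ, 0 < w.1 ∧ 0 < w.2 ∧
      w.1 * S.B.1 + w.2 * S.B.2 = w.1 * S.A.1 + w.2 * S.A.2 ∧
      (∀ p ∈ supp K f, w.1 * S.A.1 + w.2 * S.A.2 ≤ w.1 * p.1 + w.2 * p.2) ∧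
      (∀ p ∈ supp K f, w.1 * p.1 + w.2 * p.2 = w.1 * S.A.1 + w.2 * S.A.2 →
        S.A.1 ≤ p.1 ∧ p.1 ≤ S.B.1)}

/-- `|N_f|₁ = Σ_{S ∈ N_f} |S|₁`. -/
def len1N (f : PS K) : ℕ := ∑ᶠ S ∈ newtonPolygon K f, S.len1

/-- `|N_f|₂ = Σ_{S ∈ N_f} |S|₂`. -/
def len2N (f : PS K) : ℕ := ∑ᶠ S ∈ newtonPolygon K f, S.len2

/-- `[N_f, N_f] = Σ_{S,T ∈ N_f} [S,T]`. -/
def bracketN (f : PS K) : ℕ := ∑ᶠ S ∈ newtonPolygon K f, ∑ᶠ T ∈ newtonPolygon K f, bracket S T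

/-- `k`: the exponent of the highest power of `x` dividing `f`. -/
def kdiv (f : PS K) : ℕ := sInf {a : ℕ | ∃ b : ℕ, (a, b) ∈ supp K f}

/-- `l`: the exponent of the highest power of `y` dividing `f`. -/
def ldiv (f : PS K) : ℕ := sInf {b : ℕ | ∃ a : ℕ, (a, b) ∈ supp K f}

/-- `r(N_f) = Σ_{S ∈ N_f} r(S) + k + l`, where `x^k y^l` is the monomial of highest degree
dividing `f`. -/
def rNewton (f : PS K) : ℕ := (∑ᶠ S ∈ newtonPolygon K f, S.rE) + kdiv K f + ldiv K f

/-- `μ(N_f) = [N_f,N_f] - |N_f|₁ - |N_f|₂ + 1` (the Newton number of a convenient series). -/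
def muNewtonConv (f : PS K) : ℤ :=
  (bracketN K f : ℤ) - (len1N K f : ℤ) - (len2N K f : ℤ) + 1

/-- `μ(N_f) = sup_{m ∈ ℕ} μ(N_{f + x^m + y^m})`: the Newton number of an arbitrary
(reduced) power series. -/
def muNewton (f : PS K) : ℤ :=
  sSup {z : ℤ | ∃ m : ℕ, z = muNewtonConv K (f + Xv K ^ m + Yv K ^ m)}

/-- `δ(N_f) = (μ(N_f) + r(N_f) - 1)/2`. -/
def deltaNewton (f : PS K) : ℤ := (muNewton K f + (rNewton K f : ℤ) - 1) / 2

/-- `in(f,S) = Σ_{(α,β) ∈ S} c_{αβ} x^α y^β`, the initial part of `f` along the edge `S`. -/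
def initialForm (f : PS K) (S : NEdge) : PS K :=
  ofCoef K fun p => if S.mem p then coef K f p else 0

/-- `ī(f,S)`: the convenient power series with `in(f,S) = x^{α(S)} y^{β(S)} ī(f,S)`,
where `x^{α(S)} y^{β(S)}` is the monomial of highest degree dividing `in(f,S)`. -/
def inBar (f : PS K) (S : NEdge) : PS K :=
  ofCoef K fun p =>
    if S.mem (p.1 + S.A.1, p.2 + S.B.2) then coef K f (p.1 + S.A.1, p.2 + S.B.2) else 0

/-- `f` is non-degenerate (in the sense of Beelen–Pellikaan) if `ī(f,S)` is reduced
(i.e. squarefree) for every edge `S ∈ N_f`. -/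
def NonDegenerate (f : PS K) : Prop :=
  ∀ S ∈ newtonPolygon K f, Squarefree (inBar K f S)

/-- `f` is elementary if it is convenient and `N_f` consists of a single edge. -/
def Elementary (f : PS K) : Prop :=
  Convenient K f ∧ ∃ S : NEdge, newtonPolygon K f = {S}

/-- Evaluation of a power series with finite support (e.g. an initial form) at a point of `K²`. -/
def psEval (f : PS K) (v : K × K) : K :=
  ∑ᶠ p : ℕ × ℕ, coef K f p * v.1 ^ p.1 * v.2 ^ p.2

/-- The partial derivative `∂f/∂x` (for `i = 0`) resp. `∂f/∂y` (for `i = 1`). -/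
def pderivSeries (i : Fin 2) (f : PS K) : PS K :=
  ofCoef K fun p =>
    if i = 0 then ((p.1 + 1 : ℕ) : K) * coef K f (p.1 + 1, p.2)
    else ((p.2 + 1 : ℕ) : K) * coef K f (p.1, p.2 + 1)

/-- `μ(f) = i₀(∂f/∂x, ∂f/∂y)`, the Milnor number of `f`. -/
def milnor (f : PS K) : ℕ := iMult K (pderivSeries K 0 f) (pderivSeries K 1 f)

/-- `f` is strongly non-degenerate (Kouchnirenko) if for every `S ∈ N_f` the solutions of
`∂in(f,S)/∂x = ∂in(f,S)/∂y = 0` are contained in `{xy = 0}`. -/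
def StronglyNonDegenerate (f : PS K) : Prop :=
  ∀ S ∈ newtonPolygon K f, ∀ v : K × K,
    psEval K (pderivSeries K 0 (initialForm K f S)) v = 0 →
    psEval K (pderivSeries K 1 (initialForm K f S)) v = 0 → v.1 * v.2 = 0

/-- The Newton diagram `Δ(f) ⊆ ℝ²`: the convex hull of `supp f + (ℝ_{≥0})²`. -/
def diagram (f : PS K) : Set (ℝ × ℝ) :=
  convexHull ℝ {q : ℝ × ℝ | ∃ p ∈ supp K f, (p.1 : ℝ) ≤ q.1 ∧ (p.2 : ℝ) ≤ q.2}

/-- A real point lies on the Newton polygon `N_f` (i.e. on a compact face of the boundary of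
the Newton diagram) iff it belongs to the diagram and some linear form with positive
coefficients attains its minimum over the diagram at this point. -/
def OnNewtonPolygon (f : PS K) (q : ℝ × ℝ) : Prop :=
  q ∈ diagram K f ∧ ∃ w : ℝ × ℝ, 0 < w.1 ∧ 0 < w.2 ∧
    ∀ p ∈ diagram K f, w.1 * q.1 + w.2 * q.2 ≤ w.1 * p.1 + w.2 * p.2

end PlaneCurveNote

section Codimension

variable {K V : Type*} [Field K] [AddCommGroup V] [Module K V]

lemma exact_mapQ_factor (φ : V →ₗ[K] V) (S : Submodule K V) :
    Function.Exact (S.mapQ (S.map φ) φ (Submodule.le_comap_map φ S))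
      (Submodule.factor (LinearMap.map_le_range (f := φ) (p := S))) := by
  rw [LinearMap.exact_iff]
  apply le_antisymm
  · intro z hz
    obtain ⟨z, rfl⟩ := Submodule.mkQ_surjective _ z
    have hz' : z ∈ LinearMap.range φ := by simpa using hz
    obtain ⟨w, rfl⟩ := hz'
    exact ⟨Submodule.Quotient.mk w, by simp⟩
  · rintro _ ⟨z, rfl⟩
    obtain ⟨z, rfl⟩ := Submodule.mkQ_surjective _ z
    simp

lemma finite_quotient_map (φ : V →ₗ[K] V) (S : Submodule K V)
    [Module.Finite K (V ⧸ LinearMap.range φ)] [Module.Finite K (V ⧸ S)] :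
    Module.Finite K (V ⧸ S.map φ) :=
  Module.Finite.of_exact (exact_mapQ_factor φ S) (Submodule.factor_surjective _)

/-- Codimension is additive along an injective endomorphism. -/
lemma finrank_quotient_map (φ : V →ₗ[K] V) (hφ : Function.Injective φ) (S : Submodule K V)
    [Module.Finite K (V ⧸ LinearMap.range φ)] [Module.Finite K (V ⧸ S)] :
    Module.finrank K (V ⧸ S.map φ) =
      Module.finrank K (V ⧸ LinearMap.range φ) + Module.finrank K (V ⧸ S) := by
  have := finite_quotient_map φ S
  have hex := exact_mapQ_factor φ S
  rw [LinearMap.exact_iff] at hex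
  rw [← LinearMap.finrank_range_add_finrank_ker
    (Submodule.factor (LinearMap.map_le_range (f := φ) (p := S))), hex,
    LinearMap.range_eq_top.2 (Submodule.factor_surjective _), finrank_top,
    LinearMap.finrank_range_of_inj]
  rw [← LinearMap.ker_eq_bot, Submodule.ker_mapQ, Submodule.comap_map_eq_of_injective hφ]
  simp

lemma finrank_quotient_le_of_le {S T : Submodule K V} (h : S ≤ T) [Module.Finite K (V ⧸ S)] :
    Module.finrank K (V ⧸ T) ≤ Module.finrank K (V ⧸ S) :=
  LinearMap.finrank_le_finrank_of_surjective (Submodule.factor_surjective h)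

lemma finite_quotient_of_le {S T : Submodule K V} (h : S ≤ T) [Module.Finite K (V ⧸ S)] :
    Module.Finite K (V ⧸ T) :=
  Module.Finite.of_surjective _ (Submodule.factor_surjective h)

lemma eq_of_le_of_finrank_quotient_le {S T : Submodule K V} (h : S ≤ T)
    [Module.Finite K (V ⧸ S)] (hr : Module.finrank K (V ⧸ S) ≤ Module.finrank K (V ⧸ T)) :
    S = T := by
  have := finite_quotient_of_le h
  have hinj : Function.Injective (Submodule.factor h) :=
    (LinearMap.injective_iff_surjective_of_finrank_eq_finrank
      (hr.antisymm (finrank_quotient_le_of_le h))).2 (Submodule.factor_surjective h)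
  refine le_antisymm h fun x hx => ?_
  rw [← Submodule.Quotient.mk_eq_zero]
  apply hinj
  simpa using hx

end Codimension

section Colength

variable (K : Type*) {B : Type*} [Field K] [CommRing B] [Algebra K B]

/-- The dimension of `B / gB` over the base field. -/
def colength (g : B) : ℕ := Module.finrank K (B ⧸ LinearMap.range (LinearMap.mulLeft K g))

variable (B) in
/-- The two properties of the local ring of a branch which make the colength a valuation:
principal ideals have finite colength, and any two elements are comparable for divisibility
up to multiplication by a suitable ideal. -/
structure IsBranchRing : Prop where
  finite : ∀ g : B, g ≠ 0 → Module.Finite K (B ⧸ LinearMap.range (LinearMap.mulLeft K g))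
  total : ∀ g h : B, ∃ J : Ideal B, J ≠ ⊥ ∧
    ((∀ j ∈ J, ∃ i ∈ J, h * j = g * i) ∨ (∀ j ∈ J, ∃ i ∈ J, g * j = h * i))

variable {K}

lemma isUnit_of_colength_eq_zero {g : B}
    [Module.Finite K (B ⧸ LinearMap.range (LinearMap.mulLeft K g))]
    (h : colength K g = 0) : IsUnit g := by
  have hs : Subsingleton (B ⧸ LinearMap.range (LinearMap.mulLeft K g)) :=
    Module.finrank_zero_iff.1 h
  rw [Submodule.Quotient.subsingleton_iff] at hs
  have h1 : (1 : B) ∈ LinearMap.range (LinearMap.mulLeft K g) := hs ▸ Submodule.mem_top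
  obtain ⟨u, hu⟩ := h1
  exact IsUnit.of_mul_eq_one u (by simpa using hu)

lemma colength_of_isUnit {g : B} (hg : IsUnit g) : colength K g = 0 := by
  obtain ⟨u, rfl⟩ := hg
  have : LinearMap.range (LinearMap.mulLeft K (u : B)) = ⊤ := by
    rw [LinearMap.range_eq_top]
    exact fun b => ⟨↑u⁻¹ * b, by simp⟩
  rw [colength, this]
  exact Module.finrank_zero_of_subsingleton

lemma range_mulLeft_mul (g h : B) : LinearMap.range (LinearMap.mulLeft K (g * h)) =
    (LinearMap.range (LinearMap.mulLeft K h)).map (LinearMap.mulLeft K g) := by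
  rw [LinearMap.mulLeft_mul, LinearMap.range_comp]

lemma IsBranchRing.finite_quotient_ideal (hB : IsBranchRing K B) {J : Ideal B} (hJ : J ≠ ⊥) :
    Module.Finite K (B ⧸ J.restrictScalars K) := by
  obtain ⟨j, hj, hj0⟩ := Submodule.exists_mem_ne_zero_of_ne_bot hJ
  have := hB.finite j hj0
  refine finite_quotient_of_le (S := LinearMap.range (LinearMap.mulLeft K j)) ?_
  rintro _ ⟨b, rfl⟩
  exact J.mul_mem_right b hj

/-- Every element is a scalar modulo the ideal generated by `X` and `Y`. -/
def GeneratesModScalars (K : Type*) {B : Type*} [Field K] [CommRing B] [Algebra K B]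
    (X Y : B) : Prop :=
  ∀ g : B, ∃ (l : K) (a b : B), g = algebraMap K B l + a * X + b * Y

namespace GeneratesModScalars

variable {X Y : B}

lemma symm (h : GeneratesModScalars K X Y) : GeneratesModScalars K Y X := fun g => by
  obtain ⟨l, a, b, hg⟩ := h g
  exact ⟨l, b, a, by rw [hg]; ring⟩

lemma replace_left (h : GeneratesModScalars K X Y) {a b : B} (ha : IsUnit a) :
    GeneratesModScalars K (a * X + b * Y) Y := fun g => by
  obtain ⟨u, rfl⟩ := ha
  obtain ⟨l, a', b', hg⟩ := h g
  refine ⟨l, a' * ↑u⁻¹, b' - a' * ↑u⁻¹ * b, ?_⟩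
  rw [hg]
  linear_combination (-(a' * X)) * u.inv_mul

lemma sub_mul_right (h : GeneratesModScalars K X Y) (b : B) :
    GeneratesModScalars K X (Y - b * X) := by
  have := h.symm.replace_left (a := 1) (b := -b) isUnit_one
  rw [show 1 * Y + -b * X = Y - b * X by ring] at this
  exact this.symm

lemma colength_le_of_dvd_pow (h : GeneratesModScalars K X Y) {k : ℕ} (hk : X ∣ Y ^ k) :
    colength K X ≤ k := by
  set R := LinearMap.range (LinearMap.mulLeft K X) with hR
  have hX (a : B) : R.mkQ (a * X) = 0 := by
    rw [Submodule.mkQ_apply, Submodule.Quotient.mk_eq_zero]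
    exact ⟨a, by simp [mul_comm]⟩
  have hexp : ∀ j : ℕ, ∀ g : B, ∃ b : B,
      R.mkQ (g - b * Y ^ j) ∈ Submodule.span K (Set.range fun i : Fin j => R.mkQ (Y ^ (i : ℕ))) := by
    intro j
    induction j with
    | zero => exact fun g => ⟨g, by simp⟩
    | succ j ih =>
      intro g
      obtain ⟨b, hb⟩ := ih g
      obtain ⟨l, a, b', hb'⟩ := h b
      refine ⟨b', ?_⟩
      have hsplit : g - b' * Y ^ (j + 1) = (g - b * Y ^ j) + (a * Y ^ j) * X + l • Y ^ j := by
        rw [hb', Algebra.smul_def]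
        ring
      rw [hsplit, map_add, map_add, hX, add_zero, map_smul]
      refine add_mem (Submodule.span_mono ?_ hb) (Submodule.smul_mem _ _ (Submodule.subset_span ?_))
      · rintro _ ⟨i, rfl⟩
        exact ⟨i.castSucc, rfl⟩
      · exact ⟨Fin.last j, rfl⟩
  have htop : Submodule.span K (Set.range fun i : Fin k => R.mkQ (Y ^ (i : ℕ))) = ⊤ := by
    rw [eq_top_iff]
    rintro z -
    obtain ⟨g, rfl⟩ := R.mkQ_surjective z
    obtain ⟨b, hb⟩ := hexp k g
    obtain ⟨d, hd⟩ := hk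
    rwa [hd, show g - b * (X * d) = g - (b * d) * X by ring, map_sub, hX, sub_zero] at hb
  calc colength K X = Module.finrank K (⊤ : Submodule K (B ⧸ R)) := (finrank_top K (B ⧸ R)).symm
    _ = Module.finrank K (Submodule.span K (Set.range fun i : Fin k => R.mkQ (Y ^ (i : ℕ)))) := by
      rw [htop]
    _ ≤ Fintype.card (Fin k) := finrank_range_le_card _
    _ = k := Fintype.card_fin k

end GeneratesModScalars

variable [IsDomain B]

lemma mulLeft_injective_of_ne_zero {g : B} (hg : g ≠ 0) :
    Function.Injective (LinearMap.mulLeft K g) := fun a b hab =>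
  mul_left_cancel₀ hg (by simpa using hab)

namespace IsBranchRing

lemma colength_mul (hB : IsBranchRing K B) {g h : B} (hg : g ≠ 0) (hh : h ≠ 0) :
    colength K (g * h) = colength K g + colength K h := by
  have := hB.finite g hg
  have := hB.finite h hh
  rw [colength, range_mulLeft_mul, finrank_quotient_map _ (mulLeft_injective_of_ne_zero hg)]
  rfl

lemma colength_pow (hB : IsBranchRing K B) {g : B} (hg : g ≠ 0) (k : ℕ) :
    colength K (g ^ k) = k * colength K g := by
  induction k with
  | zero => simp [colength_of_isUnit]
  | succ k ih => rw [pow_succ, hB.colength_mul (pow_ne_zero _ hg) hg, ih]; ring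

lemma colength_le_add_of_ideal (hB : IsBranchRing K B) {g h : B} (hg : g ≠ 0) (hgh : g + h ≠ 0)
    {J : Ideal B} (hJ : J ≠ ⊥) (hJm : ∀ j ∈ J, ∃ i ∈ J, h * j = g * i) :
    colength K g ≤ colength K (g + h) := by
  have := hB.finite_quotient_ideal hJ
  have := hB.finite g hg
  have := hB.finite _ hgh
  have := finite_quotient_map (LinearMap.mulLeft K (g + h)) (J.restrictScalars K)
  have hle : (J.restrictScalars K).map (LinearMap.mulLeft K (g + h)) ≤
      (J.restrictScalars K).map (LinearMap.mulLeft K g) := by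
    rintro _ ⟨j, hj, rfl⟩
    obtain ⟨i, hi, hij⟩ := hJm j hj
    exact ⟨j + i, J.add_mem hj hi, by simp [mul_add, add_mul, hij]⟩
  have key := finrank_quotient_le_of_le hle
  rw [finrank_quotient_map _ (mulLeft_injective_of_ne_zero hg),
    finrank_quotient_map _ (mulLeft_injective_of_ne_zero hgh)] at key
  exact Nat.le_of_add_le_add_right key

lemma min_colength_le_add (hB : IsBranchRing K B) {g h : B} (hg : g ≠ 0) (hh : h ≠ 0)
    (hgh : g + h ≠ 0) :
    min (colength K g) (colength K h) ≤ colength K (g + h) := by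
  obtain ⟨J, hJ, hJm | hJm⟩ := hB.total g h
  · exact (min_le_left _ _).trans (hB.colength_le_add_of_ideal hg hgh hJ hJm)
  · rw [add_comm] at hgh ⊢
    exact (min_le_right _ _).trans (hB.colength_le_add_of_ideal hh hgh hJ hJm)

lemma colength_smul_le (hB : IsBranchRing K B) {g : B} (l : K) (h : l • g ≠ 0) :
    colength K g ≤ colength K (l • g) := by
  have hl : algebraMap K B l ≠ 0 := fun h0 => h (by rw [Algebra.smul_def, h0, zero_mul])
  have hg : g ≠ 0 := fun h0 => h (by rw [h0, smul_zero])
  rw [Algebra.smul_def, hB.colength_mul hl hg]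
  exact Nat.le_add_left _ _

/-- The space of elements of colength at least `k`, together with zero. -/
def filtration (hB : IsBranchRing K B) (k : ℕ) : Submodule K B where
  carrier := {g | g ≠ 0 → k ≤ colength K g}
  add_mem' {g h} hg hh hgh := by
    by_cases hg0 : g = 0
    · subst hg0; simpa using hh (by simpa using hgh)
    by_cases hh0 : h = 0
    · subst hh0; simpa using hg hg0
    exact (le_min (hg hg0) (hh hh0)).trans (hB.min_colength_le_add hg0 hh0 hgh)
  zero_mem' h := absurd rfl h
  smul_mem' l g hg h := by
    have hg0 : g ≠ 0 := fun h0 => h (by rw [h0, smul_zero])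
    exact (hg hg0).trans (hB.colength_smul_le l h)

lemma mem_filtration (hB : IsBranchRing K B) {k : ℕ} {g : B} :
    g ∈ hB.filtration k ↔ (g ≠ 0 → k ≤ colength K g) :=
  Iff.rfl

lemma mul_mem_filtration (hB : IsBranchRing K B) {k l : ℕ} {g h : B} (hg : g ∈ hB.filtration k)
    (hh : h ∈ hB.filtration l) : g * h ∈ hB.filtration (k + l) := fun h0 => by
  rw [hB.colength_mul (left_ne_zero_of_mul h0) (right_ne_zero_of_mul h0)]
  exact Nat.add_le_add (hg (left_ne_zero_of_mul h0)) (hh (right_ne_zero_of_mul h0))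

lemma pow_mem_filtration (hB : IsBranchRing K B) {k : ℕ} {g : B} (hg : g ∈ hB.filtration k)
    (m : ℕ) :
    g ^ m ∈ hB.filtration (m * k) := by
  induction m with
  | zero => exact fun _ => by simp
  | succ m ih =>
    rw [pow_succ, Nat.succ_mul]
    exact hB.mul_mem_filtration ih hg

lemma filtration_anti (hB : IsBranchRing K B) {k l : ℕ} (h : k ≤ l) :
    hB.filtration l ≤ hB.filtration k :=
  fun _ hg h0 => h.trans (hg h0)

lemma mem_filtration_zero (hB : IsBranchRing K B) (g : B) :
    g ∈ hB.filtration 0 := fun _ => Nat.zero_le _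

lemma finite_quotient_filtration (hB : IsBranchRing K B) {g : B} (hg : g ≠ 0) :
    Module.Finite K (B ⧸ hB.filtration (colength K g)) := by
  have := hB.finite g hg
  refine finite_quotient_of_le (S := LinearMap.range (LinearMap.mulLeft K g)) ?_
  rintro _ ⟨b, rfl⟩ h0
  have h0' : g * b ≠ 0 := h0
  change _ ≤ colength K (g * b)
  rw [hB.colength_mul hg (right_ne_zero_of_mul h0')]
  exact Nat.le_add_right _ _

/-- The codimension of the space of elements of colength at least `k`. -/
def filtrationCodim (hB : IsBranchRing K B) (k : ℕ) : ℕ := Module.finrank K (B ⧸ hB.filtration k)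

lemma map_mulLeft_filtration_le (hB : IsBranchRing K B) (c : ℕ) (X : B) :
    (hB.filtration c).map (LinearMap.mulLeft K X) ≤ hB.filtration (c + colength K X) := by
  rintro _ ⟨b, hb, rfl⟩
  rw [add_comm]
  exact hB.mul_mem_filtration (fun _ => le_rfl) hb

lemma finite_quotient_filtration_add (hB : IsBranchRing K B) {c : ℕ}
    (hc : ∀ N : ℕ, ∃ g : B, g ≠ 0 ∧ colength K g = c + N) (N : ℕ) :
    Module.Finite K (B ⧸ hB.filtration (c + N)) := by
  obtain ⟨g, hg, hgN⟩ := hc N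
  exact hgN ▸ hB.finite_quotient_filtration hg

lemma filtrationCodim_lt_succ (hB : IsBranchRing K B) {c : ℕ}
    (hc : ∀ N : ℕ, ∃ g : B, g ≠ 0 ∧ colength K g = c + N) (N : ℕ) :
    hB.filtrationCodim (c + N) < hB.filtrationCodim (c + (N + 1)) := by
  have := hB.finite_quotient_filtration_add hc (N + 1)
  by_contra! hle
  obtain ⟨g, hg, hgN⟩ := hc N
  have heq := eq_of_le_of_finrank_quotient_le (hB.filtration_anti (by lia : c + N ≤ c + (N + 1))) hle
  have hmem : g ∈ hB.filtration (c + (N + 1)) := heq ▸ fun _ => hgN.ge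
  have := hmem hg
  lia

lemma filtrationCodim_add_le (hB : IsBranchRing K B) {c : ℕ}
    (hc : ∀ N : ℕ, ∃ g : B, g ≠ 0 ∧ colength K g = c + N) (M N : ℕ) :
    hB.filtrationCodim (c + M) + N ≤ hB.filtrationCodim (c + M + N) := by
  induction N with
  | zero => simp
  | succ N ih =>
    have := hB.filtrationCodim_lt_succ hc (M + N)
    simp only [← add_assoc] at this ih ⊢
    lia

lemma finrank_quotient_map_filtration (hB : IsBranchRing K B) {c : ℕ}
    (hc : ∀ N : ℕ, ∃ g : B, g ≠ 0 ∧ colength K g = c + N) {X : B} (hX : X ≠ 0) :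
    Module.Finite K (B ⧸ (hB.filtration c).map (LinearMap.mulLeft K X)) ∧
    Module.finrank K (B ⧸ (hB.filtration c).map (LinearMap.mulLeft K X)) =
      colength K X + hB.filtrationCodim c := by
  have := hB.finite X hX
  have : Module.Finite K (B ⧸ hB.filtration c) := hB.finite_quotient_filtration_add hc 0
  exact ⟨finite_quotient_map _ _, finrank_quotient_map _ (mulLeft_injective_of_ne_zero hX) _⟩

/-- Elements of value at least `c + v(X)` are divisible by `X`. -/
lemma dvd_of_mem_filtration (hB : IsBranchRing K B) {c : ℕ}
    (hc : ∀ N : ℕ, ∃ g : B, g ≠ 0 ∧ colength K g = c + N) {X : B} (hX : X ≠ 0) {g : B}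
    (hg : g ∈ hB.filtration (c + colength K X)) : X ∣ g := by
  obtain ⟨hfin, hrank⟩ := hB.finrank_quotient_map_filtration hc hX
  have hle := hB.filtrationCodim_add_le hc 0 (colength K X)
  have heq := eq_of_le_of_finrank_quotient_le (hB.map_mulLeft_filtration_le c X)
    (by rw [hrank, add_comm]; exact hle)
  rw [← heq] at hg
  obtain ⟨b, -, rfl⟩ := hg
  exact ⟨b, rfl⟩

lemma filtrationCodim_succ (hB : IsBranchRing K B) {c : ℕ}
    (hc : ∀ N : ℕ, ∃ g : B, g ≠ 0 ∧ colength K g = c + N) {X : B} (hX : X ≠ 0)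
    (hXc : 0 < colength K X) :
    hB.filtrationCodim (c + 1) = hB.filtrationCodim c + 1 := by
  obtain ⟨hfin, hrank⟩ := hB.finrank_quotient_map_filtration hc hX
  have h0 := hB.filtrationCodim_lt_succ hc 0
  have h1 := hB.filtrationCodim_add_le hc 1 (colength K X - 1)
  have h2 : hB.filtrationCodim (c + colength K X) ≤ _ :=
    finrank_quotient_le_of_le (hB.map_mulLeft_filtration_le c X)
  rw [hrank] at h2
  rw [show c + 1 + (colength K X - 1) = c + colength K X by lia] at h1
  simp only [add_zero, zero_add] at h0
  lia

/-- At and beyond the conductor the graded pieces of the filtration are lines. -/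
lemma exists_sub_smul_mem_filtration_of_conductor (hB : IsBranchRing K B) {c : ℕ}
    (hc : ∀ N : ℕ, ∃ g : B, g ≠ 0 ∧ colength K g = c + N) {X : B} (hX : X ≠ 0)
    (hXc : 0 < colength K X) {g h : B} (hg : g ∈ hB.filtration c) (hh : h ≠ 0)
    (hhc : colength K h = c) : ∃ l : K, g - l • h ∈ hB.filtration (c + 1) := by
  have hfin := hB.finite_quotient_filtration_add hc 1
  have hle : hB.filtration (c + 1) ≤ hB.filtration (c + 1) ⊔ K ∙ h := le_sup_left
  have hle' : hB.filtration (c + 1) ⊔ K ∙ h ≤ hB.filtration c :=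
    sup_le (hB.filtration_anti c.le_succ)
      ((Submodule.span_singleton_le_iff_mem _ _).2 fun _ => hhc.ge)
  have := finite_quotient_of_le hle
  have heq : hB.filtration (c + 1) ⊔ K ∙ h = hB.filtration c := by
    apply eq_of_le_of_finrank_quotient_le hle'
    by_contra! hlt
    have h1 : hB.filtrationCodim (c + 1) ≤ _ :=
      (hB.filtrationCodim_succ hc hX hXc).trans_le (Nat.succ_le_of_lt hlt)
    have hmem : h ∈ hB.filtration (c + 1) := by
      rw [eq_of_le_of_finrank_quotient_le hle h1]
      exact Submodule.mem_sup_right (Submodule.mem_span_singleton_self h)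
    have := hmem hh
    lia
  rw [← heq] at hg
  obtain ⟨a, ha, b, hb, rfl⟩ := Submodule.mem_sup.1 hg
  obtain ⟨l, rfl⟩ := Submodule.mem_span_singleton.1 hb
  exact ⟨l, by simpa using ha⟩

/-- Two elements of the same value become, after scaling, congruent up to higher value. -/
lemma exists_sub_smul_mem_filtration (hB : IsBranchRing K B) {c : ℕ}
    (hc : ∀ N : ℕ, ∃ g : B, g ≠ 0 ∧ colength K g = c + N) {X : B} (hX : X ≠ 0)
    (hXc : 0 < colength K X) {g h : B}
    (hg : g ∈ hB.filtration (colength K h)) (hh : h ≠ 0) :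
    ∃ l : K, g - l • h ∈ hB.filtration (colength K h + 1) := by
  obtain ⟨u, hu, huc⟩ := hc 0
  obtain ⟨l, hl⟩ := hB.exists_sub_smul_mem_filtration_of_conductor
    (c := c + colength K h) (fun N => by simpa only [add_assoc] using hc (colength K h + N)) hX hXc
    (g := u * g) (h := u * h) (hB.mul_mem_filtration (fun _ => huc.ge) hg) (mul_ne_zero hu hh)
    (by rw [hB.colength_mul hu hh, huc, add_zero])
  refine ⟨l, fun h0 => ?_⟩
  rw [← mul_smul_comm, ← mul_sub] at hl
  have := hl (mul_ne_zero hu h0)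
  rw [hB.colength_mul hu h0] at this
  lia

lemma exists_generator_of_minimal (hB : IsBranchRing K B) {x y X : B}
    (h : GeneratesModScalars K x y)
    (hx : x ∈ hB.filtration 1) (hy : y ∈ hB.filtration 1) (hX : X ≠ 0) (hXc : 0 < colength K X)
    (hmin : ∀ g : B, g ≠ 0 → 0 < colength K g → colength K X ≤ colength K g) :
    ∃ Y ∈ hB.filtration 1, GeneratesModScalars K X Y := by
  have hup {g : B} (hg : g ∈ hB.filtration 1) : g ∈ hB.filtration (colength K X) :=
    fun h0 => hmin g h0 (hg h0)
  have hunit {g : B} (hg : ¬ IsUnit g) : g ∈ hB.filtration 1 := fun h0 => by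
    by_contra! hlt
    have := hB.finite g h0
    exact hg (isUnit_of_colength_eq_zero (K := K) (by lia))
  have hmul {g z : B} (hz : z ∈ hB.filtration 1) : g * z ∈ hB.filtration 1 := by
    simpa using hB.mul_mem_filtration (hB.mem_filtration_zero g) hz
  obtain ⟨l, a, b, hXab⟩ := h X
  have hl : l = 0 := by
    by_contra hl
    have hu : IsUnit (algebraMap K B l) := (isUnit_iff_ne_zero.2 hl).map _
    have hmem : algebraMap K B l ∈ hB.filtration 1 := by
      rw [show algebraMap K B l = X - a * x - b * y by rw [hXab]; ring]
      exact sub_mem (sub_mem (fun _ => hXc) (hmul hx)) (hmul hy)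
    have := hmem hu.ne_zero
    rw [colength_of_isUnit hu] at this
    lia
  rw [hl, map_zero, zero_add] at hXab
  by_cases ha : IsUnit a
  · exact ⟨y, hy, hXab ▸ h.replace_left ha⟩
  by_cases hb : IsUnit b
  · exact ⟨x, hx, by rw [hXab, add_comm]; exact h.symm.replace_left hb⟩
  have hmem : X ∈ hB.filtration (1 + colength K X) := by
    rw [hXab]
    exact add_mem (hXab ▸ hB.mul_mem_filtration (hunit ha) (hup hx))
      (hXab ▸ hB.mul_mem_filtration (hunit hb) (hup hy))
  have := hmem hX
  lia

lemma exists_generator_mem_filtration (hB : IsBranchRing K B) {c : ℕ}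
    (hc : ∀ N : ℕ, ∃ g : B, g ≠ 0 ∧ colength K g = c + N) {X Y : B}
    (h : GeneratesModScalars K X Y) (hX : X ≠ 0)
    (hXc : 0 < colength K X) (hY : Y ∈ hB.filtration 1) {m : ℕ}
    (hm : ∀ g : B, g ≠ 0 → colength K g < m → colength K X ∣ colength K g) :
    ∃ Y' ∈ hB.filtration m, GeneratesModScalars K X Y' := by
  obtain hm0 | hm0 := m.eq_zero_or_pos
  · exact ⟨Y, hm0 ▸ hB.mem_filtration_zero Y, h⟩
  have step : ∀ k, 1 ≤ k → k ≤ m → ∃ Y' ∈ hB.filtration k, GeneratesModScalars K X Y' := by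
    intro k hk
    induction k, hk using Nat.le_induction with
    | base => exact fun _ => ⟨Y, hY, h⟩
    | succ k hk ih =>
      intro hkm
      obtain ⟨Y', hY', h'⟩ := ih (by lia)
      by_cases hmem : Y' ∈ hB.filtration (k + 1)
      · exact ⟨Y', hmem, h'⟩
      rw [mem_filtration] at hmem
      push Not at hmem
      have hYk : colength K Y' = k := le_antisymm (by lia) (hY' hmem.1)
      obtain ⟨j, hj⟩ := hm Y' hmem.1 (by lia)
      have hXj : colength K (X ^ j) = k := by rw [hB.colength_pow hX, ← hYk, hj, mul_comm]
      obtain ⟨l, hl⟩ := hB.exists_sub_smul_mem_filtration hc hX hXc (g := Y') (h := X ^ j)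
        (hXj ▸ hY') (pow_ne_zero _ hX)
      rw [hXj] at hl
      have hj0 : j ≠ 0 := by
        rintro rfl
        lia
      refine ⟨_, hl, ?_⟩
      obtain ⟨i, rfl⟩ := Nat.exists_eq_succ_of_ne_zero hj0
      rw [Algebra.smul_def, Nat.succ_eq_add_one, pow_succ, ← mul_assoc]
      exact h'.sub_mul_right _
  exact step m hm0 le_rfl

/-- The conductor bound for a ring in which the colength is a valuation. -/
theorem le_conductor_add (hB : IsBranchRing K B) {c : ℕ}
    (hc : ∀ N : ℕ, ∃ g : B, g ≠ 0 ∧ colength K g = c + N) {x y X : B}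
    (h : GeneratesModScalars K x y)
    (hx : x ∈ hB.filtration 1) (hy : y ∈ hB.filtration 1) (hX : X ≠ 0) (hXc : 0 < colength K X)
    (hmin : ∀ g : B, g ≠ 0 → 0 < colength K g → colength K X ≤ colength K g) {m : ℕ} (hm0 : 0 < m)
    (hm : ∀ g : B, g ≠ 0 → colength K g < m → colength K X ∣ colength K g) :
    (colength K X - 1) * m + Nat.gcd (colength K X) m ≤ c + colength K X := by
  obtain ⟨Y₀, hY₀, h₀⟩ := hB.exists_generator_of_minimal h hx hy hX hXc hmin
  obtain ⟨Y, hY, hXY⟩ := hB.exists_generator_mem_filtration hc h₀ hX hXc hY₀ hm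
  have hndvd : ¬ X ∣ Y ^ (colength K X - 1) := fun hd => by
    have := hXY.colength_le_of_dvd_pow hd
    lia
  set n := colength K X with hn
  set d := Nat.gcd n m with hd
  have hd0 : 0 < d := Nat.gcd_pos_of_pos_left m hXc
  suffices hφ : ∃ φ ∈ hB.filtration ((n - 1) * m + (d - 1)), X ∣ φ - Y ^ (n - 1) by
    obtain ⟨φ, hφ, hφY⟩ := hφ
    by_contra! hlt
    have hdvd : X ∣ φ :=
      hB.dvd_of_mem_filtration hc hX (hB.filtration_anti (by rw [← hn]; lia) hφ)
    exact hndvd ((dvd_sub_right hdvd).1 hφY)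
  by_cases hmem : Y ∈ hB.filtration (m + 1)
  · refine ⟨Y ^ (n - 1), hB.filtration_anti ?_ (hB.pow_mem_filtration hmem (n - 1)), by simp⟩
    have : d ≤ n := Nat.le_of_dvd hXc (Nat.gcd_dvd_left n m)
    rw [mul_add, mul_one]
    lia
  rw [mem_filtration] at hmem
  push Not at hmem
  obtain ⟨hY0, hYlt⟩ := hmem
  have hYm : colength K Y = m := le_antisymm (by lia) (hY hY0)
  obtain ⟨n', hn'⟩ : d ∣ n := Nat.gcd_dvd_left n m
  obtain ⟨m', hm'⟩ : d ∣ m := Nat.gcd_dvd_right n m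
  have hn'0 : 0 < n' := Nat.pos_of_ne_zero (by rintro rfl; lia)
  have hm'0 : 0 < m' := Nat.pos_of_ne_zero (by rintro rfl; lia)
  have hXpow : colength K (X ^ m') = n' * m := by
    rw [hB.colength_pow hX, ← hn, hn', hm']
    ring
  obtain ⟨l, hl⟩ := hB.exists_sub_smul_mem_filtration hc hX hXc (g := Y ^ n') (h := X ^ m')
    (hXpow ▸ hB.pow_mem_filtration hY n') (pow_ne_zero _ hX)
  rw [hXpow] at hl
  obtain ⟨e, he⟩ := Nat.exists_eq_add_of_lt hd0
  obtain ⟨k, hk⟩ := Nat.exists_eq_add_of_lt hn'0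
  have hexp : n - 1 = n' * e + k := by
    have : n = n' * e + k + 1 := by rw [hn', he, hk]; ring
    lia
  refine ⟨(Y ^ n' - l • X ^ m') ^ e * Y ^ k, hB.filtration_anti (le_of_eq ?_)
    (hB.mul_mem_filtration (hB.pow_mem_filtration hl e) (hB.pow_mem_filtration hY k)), ?_⟩
  · rw [hexp, show d - 1 = e by lia]
    ring
  · rw [hexp, pow_add, pow_mul, ← sub_mul]
    refine Dvd.dvd.mul_right (dvd_trans ?_ (sub_dvd_pow_sub_pow _ _ e)) _
    rw [sub_sub_cancel_left, dvd_neg, Algebra.smul_def]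
    exact Dvd.dvd.mul_left (dvd_pow_self X hm'0.ne') _

end IsBranchRing

end Colength

section CompleteDVR

open Polynomial IsLocalRing

variable {A : Type*} [CommRing A] [IsDomain A] [IsDiscreteValuationRing A]
  [IsAdicComplete (maximalIdeal A) A]

lemma Irreducible.isUnit_coeff_zero_or_isUnit_leadingCoeff {q : A[X]} (hq : Irreducible q)
    (hdeg : q.natDegree ≠ 0) : IsUnit (q.coeff 0) ∨ IsUnit q.leadingCoeff := by
  obtain ⟨π, hπ⟩ := IsDiscreteValuationRing.exists_irreducible A
  have hmap : (q : PowerSeries A).map (residue A) ≠ 0 := by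
    intro h0
    have hdvd : C π ∣ q := by
      rw [C_dvd_iff_dvd_coeff]
      intro i
      have hi := congrArg (PowerSeries.coeff i) h0
      rw [PowerSeries.coeff_map, coeff_coe, map_zero, residue_eq_zero_iff, hπ.maximalIdeal_eq,
        Ideal.mem_span_singleton] at hi
      exact hi
    exact hπ.not_isUnit (hq.isPrimitive hdeg π hdvd)
  obtain ⟨D, u, hDu⟩ := PowerSeries.exists_isWeierstrassFactorization hmap
  have hD := hDu.isDistinguishedAt
  have hDq : D ∣ q := by
    rw [← Ideal.mem_span_singleton, ← Ideal.Quotient.eq_zero_iff_mem]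
    apply hD.algEquivQuotient.injective
    rw [map_zero]
    change Ideal.Quotient.mk _ (Polynomial.coeToPowerSeries.algHom A q) = 0
    rw [Ideal.Quotient.eq_zero_iff_mem, Ideal.mem_span_singleton]
    exact ⟨u, by simpa using hDu.eq_mul⟩
  obtain ⟨r, hr⟩ := hDq
  rcases hq.isUnit_or_isUnit hr with hD1 | hr1
  · left
    have hqu : (q : PowerSeries A) = u := by
      simpa [hD.monic.eq_one_of_isUnit hD1] using hDu.eq_mul
    have h0 := (hqu ▸ hDu.isUnit).map (PowerSeries.constantCoeff (R := A))
    simpa using h0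
  · right
    rw [hr, leadingCoeff_mul, hD.monic.leadingCoeff, one_mul]
    obtain ⟨a, ha, rfl⟩ := Polynomial.isUnit_iff.1 hr1
    simpa using ha

lemma exists_ideal_of_isIntegral {B : Type*} [CommRing B] [IsDomain B] {g h : B} (hg : g ≠ 0)
    (hz : IsIntegral B (algebraMap B (FractionRing B) h / algebraMap B (FractionRing B) g)) :
    ∃ J : Ideal B, J ≠ ⊥ ∧ ∀ j ∈ J, ∃ i ∈ J, h * j = g * i := by
  set L := FractionRing B
  set z : L := algebraMap B L h / algebraMap B L g with hzdef
  obtain ⟨r, hr, hrz⟩ := hz.isAlmostIntegral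
  have hg' : algebraMap B L g ≠ 0 := by simpa using hg
  refine ⟨{ carrier := {b | ∀ n : ℕ, b • z ^ n ∈ (algebraMap B L).range}
            add_mem' := fun ha hb n => ?_
            zero_mem' := fun n => ?_
            smul_mem' := fun s b hb n => ?_ }, ?_, fun j hj => ?_⟩
  · rw [add_smul]
    exact add_mem (ha n) (hb n)
  · rw [zero_smul]
    exact zero_mem _
  · rw [smul_eq_mul, mul_smul, Algebra.smul_def]
    exact mul_mem ⟨s, rfl⟩ (hb n)
  · intro h0
    have : r ∈ (⊥ : Ideal B) := h0 ▸ hrz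
    exact nonZeroDivisors.ne_zero hr this
  · obtain ⟨i, hi⟩ := hj 1
    refine ⟨i, fun n => ?_, ?_⟩
    · obtain ⟨k, hk⟩ := hj (n + 1)
      refine ⟨k, ?_⟩
      rw [hk, Algebra.smul_def, Algebra.smul_def, hi, Algebra.smul_def]
      ring
    · apply IsFractionRing.injective B L
      rw [map_mul, map_mul, hi, Algebra.smul_def, hzdef, pow_one, mul_comm (algebraMap B L j),
        ← mul_assoc, mul_div_cancel₀ _ hg']

lemma exists_ideal_comparing {B : Type*} [CommRing B] [IsDomain B] [Algebra A B]
    [Module.Finite A B] [FaithfulSMul A B] (g h : B) :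
    ∃ J : Ideal B, J ≠ ⊥ ∧
      ((∀ j ∈ J, ∃ i ∈ J, h * j = g * i) ∨ (∀ j ∈ J, ∃ i ∈ J, g * j = h * i)) := by
  rcases eq_or_ne g 0 with rfl | hg
  · exact ⟨⊤, top_ne_bot, .inr fun j _ => ⟨0, trivial, by simp⟩⟩
  rcases eq_or_ne h 0 with rfl | hh
  · exact ⟨⊤, top_ne_bot, .inl fun j _ => ⟨0, trivial, by simp⟩⟩
  let L := FractionRing B
  have hg' : algebraMap B L g ≠ 0 := by simpa using hg
  have hh' : algebraMap B L h ≠ 0 := by simpa using hh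
  set z : L := algebraMap B L h / algebraMap B L g with hzdef
  have hz0 : z ≠ 0 := div_ne_zero hh' hg'
  have hint : ∀ b : B, IsAlgebraic A (algebraMap B L b) := fun b =>
    ((Algebra.IsIntegral.isIntegral (R := A) b).map
      (IsScalarTower.toAlgHom A B L)).isAlgebraic
  have halg : IsAlgebraic A z := (hint h).mul (hint g).inv
  let I : Ideal A[X] := RingHom.ker (aeval (R := A) z)
  have hI : I ≠ ⊥ := by
    obtain ⟨p, hp0, hp⟩ := halg
    intro h0
    exact hp0 (by simpa [h0] using (show p ∈ I from hp))
  obtain ⟨q, hqI, hq⟩ := (RingHom.ker_isPrime (aeval (R := A) z)).exists_mem_prime_of_ne_bot hI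
  have hq0 : aeval z q = 0 := hqI
  have hdeg : q.natDegree ≠ 0 := by
    intro hd
    rw [natDegree_eq_zero] at hd
    obtain ⟨a, rfl⟩ := hd
    rw [aeval_C, IsScalarTower.algebraMap_apply A B L] at hq0
    have := (injective_iff_map_eq_zero _).1 (FaithfulSMul.algebraMap_injective A B) a
      ((injective_iff_map_eq_zero _).1 (IsFractionRing.injective B L) _ hq0)
    exact hq.ne_zero (by simp [this])
  have key : IsIntegral A z ∨ IsIntegral A z⁻¹ := by
    rcases hq.irreducible.isUnit_coeff_zero_or_isUnit_leadingCoeff hdeg with hu | hu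
    · right
      obtain ⟨b, hb⟩ := hu.exists_left_inv
      refine ⟨C b * q.reverse, monic_C_mul_of_mul_leadingCoeff_eq_one ?_, ?_⟩
      · rw [reverse_leadingCoeff, trailingCoeff, natTrailingDegree_eq_zero_of_constantCoeff_ne_zero]
        · exact hb
        · rintro h0
          rw [constantCoeff_apply] at h0
          simp [h0] at hb
      · rw [eval₂_mul]
        let := invertibleOfNonzero hz0
        have hrev := eval₂_reverse_eq_zero_iff (algebraMap A L) z q
        rw [invOf_eq_inv] at hrev
        rw [hrev.2 hq0, mul_zero]
    · left
      obtain ⟨b, hb⟩ := hu.exists_left_inv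
      exact ⟨C b * q, monic_C_mul_of_mul_leadingCoeff_eq_one hb, by
        rw [eval₂_mul, ← aeval_def, ← aeval_def, hq0, mul_zero]⟩
  rcases key with hz | hz
  · obtain ⟨J, hJ, hJ'⟩ := exists_ideal_of_isIntegral hg (hz.tower_top (A := B))
    exact ⟨J, hJ, .inl hJ'⟩
  · rw [hzdef, inv_div] at hz
    obtain ⟨J, hJ, hJ'⟩ := exists_ideal_of_isIntegral hh (hz.tower_top (A := B))
    exact ⟨J, hJ, .inr hJ'⟩

end CompleteDVR

section Weierstrass

open Polynomial IsLocalRing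

variable {A : Type*} [CommRing A] [IsLocalRing A]

lemma Polynomial.IsDistinguishedAt.natDegree_eq_zero_of_dvd {D p : A[X]}
    (hD : D.IsDistinguishedAt (maximalIdeal A)) (hp : p.Monic) (hpD : p ∣ D)
    (hp0 : IsUnit (p : PowerSeries A)) : p.natDegree = 0 := by
  have hdvd : p.map (residue A) ∣ X ^ D.natDegree := by
    have h := Polynomial.map_dvd (residue A) hpD
    rwa [show D.map (residue A) = X ^ D.natDegree from hD.map_eq_X_pow] at h
  obtain ⟨i, -, hi⟩ := (dvd_prime_pow prime_X _).1 hdvd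
  have hpi := eq_of_monic_of_associated (hp.map _) (monic_X_pow i) hi
  have hdeg : p.natDegree = i := by
    rw [← hp.natDegree_map (residue A), hpi, natDegree_X_pow]
  by_contra h0
  have hu : IsUnit (p.coeff 0) := by
    simpa using hp0.map (PowerSeries.constantCoeff (R := A))
  have hc := congrArg (fun q => q.coeff 0) hpi
  simp only [coeff_map, coeff_X_pow, ← hdeg, Ne.symm h0, if_false] at hc
  exact (hu.map (residue A)).ne_zero hc

variable [IsDomain A] [IsAdicComplete (maximalIdeal A) A] {g : PowerSeries A}

lemma PowerSeries.irreducible_weierstrassDistinguished (hg : Irreducible g)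
    (hmap : g.map (residue A) ≠ 0) : Irreducible (g.weierstrassDistinguished hmap) := by
  set D := g.weierstrassDistinguished hmap with hDdef
  have hD : D.IsDistinguishedAt (maximalIdeal A) := isDistinguishedAt_weierstrassDistinguished hmap
  have heq : g = D * g.weierstrassUnit hmap := g.eq_weierstrassDistinguished_mul_weierstrassUnit hmap
  have hu := g.isUnit_weierstrassUnit hmap
  rw [hD.monic.irreducible_iff_natDegree']
  refine ⟨fun h1 => hg.not_isUnit ?_, fun p q hp hq hpq => ?_⟩
  · rw [heq, h1]
    simpa using hu
  rw [← hpq, Polynomial.coe_mul, mul_assoc] at heq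
  rcases hg.isUnit_or_isUnit heq with h1 | h1
  · have := hD.natDegree_eq_zero_of_dvd hp ⟨q, hpq.symm⟩ h1
    rw [← hpq, hp.natDegree_mul hq, this]
    simp
    omega
  · have := hD.natDegree_eq_zero_of_dvd hq ⟨p, by rw [mul_comm, hpq]⟩ (isUnit_of_mul_isUnit_left h1)
    simp [this]

variable [UniqueFactorizationMonoid A]

lemma PowerSeries.quotient_span_singleton (hg : Irreducible g)
    (hmap : g.map (residue A) ≠ 0) :
    IsDomain (PowerSeries A ⧸ Ideal.span {g}) ∧ Module.Finite A (PowerSeries A ⧸ Ideal.span {g}) ∧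
      Function.Injective (algebraMap A (PowerSeries A ⧸ Ideal.span {g})) := by
  let e := g.algEquivQuotientWeierstrassDistinguished hmap
  have hD := (isDistinguishedAt_weierstrassDistinguished hmap).monic
  have hprime := (irreducible_weierstrassDistinguished hg hmap).prime
  have : (Ideal.span {g.weierstrassDistinguished hmap}).IsPrime :=
    (Ideal.span_singleton_prime hprime.ne_zero).2 hprime
  have := hD.finite_quotient
  have := hD.free_quotient
  refine ⟨e.symm.toMulEquiv.isDomain, Module.Finite.equiv e.toLinearEquiv, ?_⟩
  rw [← e.toAlgHom.comp_algebraMap]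
  exact e.injective.comp (FaithfulSMul.algebraMap_injective A _)

end Weierstrass

section FiniteOverPowerSeries

open PowerSeries

lemma finite_quotient_mulLeft_pow {K B : Type*} [Field K] [CommRing B] [Algebra K B] {x : B}
    (h : Module.Finite K (B ⧸ LinearMap.range (LinearMap.mulLeft K x))) (m : ℕ) :
    Module.Finite K (B ⧸ LinearMap.range (LinearMap.mulLeft K (x ^ m))) := by
  induction m with
  | zero =>
    rw [pow_zero, LinearMap.mulLeft_one, LinearMap.range_id]
    infer_instance
  | succ m ih =>
    rw [pow_succ', range_mulLeft_mul]
    exact finite_quotient_map _ _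

variable {K B : Type*} [Field K] [CommRing B] [Algebra K B] [Algebra K⟦X⟧ B]
  [IsScalarTower K K⟦X⟧ B] [Module.Finite K⟦X⟧ B]

variable (K B) in
lemma finite_quotient_mulLeft_X :
    Module.Finite K (B ⧸ LinearMap.range (LinearMap.mulLeft K (algebraMap K⟦X⟧ B X))) := by
  obtain ⟨s, hs⟩ := Module.Finite.fg_top (R := K⟦X⟧) (M := B)
  set S := LinearMap.range (LinearMap.mulLeft K (algebraMap K⟦X⟧ B X)) with hS
  have key : ∀ b : B, b ∈ Submodule.span K (s : Set B) ⊔ S := by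
    intro b
    have hb : b ∈ Submodule.span K⟦X⟧ (s : Set B) := hs ▸ trivial
    induction hb using Submodule.span_induction with
    | mem b hb => exact Submodule.mem_sup_left (Submodule.subset_span hb)
    | zero => exact zero_mem _
    | add b c _ _ hb hc => exact add_mem hb hc
    | smul a b _ hb =>
      have ha : a • b = (constantCoeff a : K) • b +
          algebraMap K⟦X⟧ B X * ((mk fun p => coeff (p + 1) a) • b) := by
        conv_lhs => rw [eq_X_mul_shift_add_const a]
        rw [add_smul, add_comm, mul_smul, Algebra.smul_def X]
        congr 1
        rw [← algebraMap_smul K⟦X⟧ (constantCoeff a) b]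
        rfl
      rw [ha]
      exact add_mem (Submodule.smul_mem _ _ hb) (Submodule.mem_sup_right ⟨_, rfl⟩)
  refine Module.Finite.of_surjective
    (S.mkQ.comp (Submodule.span K (s : Set B)).subtype) fun b => ?_
  obtain ⟨b, rfl⟩ := S.mkQ_surjective b
  obtain ⟨u, hu, w, hw, rfl⟩ := Submodule.mem_sup.1 (key b)
  exact ⟨⟨u, hu⟩, by simpa using hw⟩

lemma isBranchRing_of_finite [IsDomain B] (hinj : Function.Injective (algebraMap K⟦X⟧ B)) :
    IsBranchRing K B where
  finite g hg := by
    have := (faithfulSMul_iff_algebraMap_injective K⟦X⟧ B).2 hinj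
    have hne : (Ideal.span {g}).comap (algebraMap K⟦X⟧ B) ≠ ⊥ :=
      Ideal.comap_ne_bot_of_integral_mem hg (Ideal.mem_span_singleton_self g)
        (Algebra.IsIntegral.isIntegral g)
    obtain ⟨a, ha, ha0⟩ := Submodule.exists_mem_ne_zero_of_ne_bot hne
    obtain ⟨m, u, hu⟩ := IsDiscreteValuationRing.associated_pow_irreducible ha0
      (X_prime (R := K)).irreducible
    have := finite_quotient_mulLeft_pow (finite_quotient_mulLeft_X K B) m
    refine finite_quotient_of_le (S := LinearMap.range
      (LinearMap.mulLeft K (algebraMap K⟦X⟧ B X ^ m))) ?_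
    obtain ⟨b, hb⟩ := Ideal.mem_span_singleton.1 (Ideal.mem_comap.1 ha)
    rintro _ ⟨w, rfl⟩
    refine ⟨b * algebraMap K⟦X⟧ B (u : K⟦X⟧) * w, ?_⟩
    simp only [LinearMap.mulLeft_apply]
    rw [← map_pow, ← hu, map_mul, hb]
    ring
  total g h := by
    have := (faithfulSMul_iff_algebraMap_injective K⟦X⟧ B).2 hinj
    have : IsAdicComplete (IsLocalRing.maximalIdeal K⟦X⟧) K⟦X⟧ := by
      rw [maximalIdeal_eq_span_X]
      infer_instance
    exact exists_ideal_comparing (A := K⟦X⟧) g h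

end FiniteOverPowerSeries

section Quotient

variable {K P P' : Type*} [Field K] [CommRing P] [Algebra K P] [CommRing P'] [Algebra K P']

lemma finrank_quotient_span_pair (e : P ≃ₐ[K] P') (f g : P) :
    Module.finrank K (P ⧸ Ideal.span {f, g}) =
      colength K (Ideal.Quotient.mk (Ideal.span {e f}) (e g)) := by
  let S := LinearMap.range
    (LinearMap.mulLeft K (Ideal.Quotient.mk (Ideal.span {e f}) (e g)))
  let φ : P →ₗ[K] (P' ⧸ Ideal.span {e f}) ⧸ S :=
    S.mkQ ∘ₗ (Ideal.Quotient.mkₐ K (Ideal.span {e f})).toLinearMap ∘ₗ e.toLinearMap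
  have hφ : Function.Surjective φ :=
    (S.mkQ_surjective.comp Ideal.Quotient.mk_surjective).comp e.surjective
  have hker : LinearMap.ker φ = (Ideal.span {f, g}).restrictScalars K := by
    ext p
    rw [Submodule.restrictScalars_mem, Ideal.mem_span_pair, LinearMap.mem_ker]
    change S.mkQ (Ideal.Quotient.mk (Ideal.span {e f}) (e p)) = 0 ↔ _
    rw [Submodule.mkQ_apply, Submodule.Quotient.mk_eq_zero]
    constructor
    · rintro ⟨w, hw⟩
      obtain ⟨w, rfl⟩ := Ideal.Quotient.mk_surjective w
      obtain ⟨w, rfl⟩ := e.surjective w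
      rw [LinearMap.mulLeft_apply, ← map_mul, eq_comm, Ideal.Quotient.mk_eq_mk_iff_sub_mem,
        Ideal.mem_span_singleton'] at hw
      obtain ⟨a, ha⟩ := hw
      obtain ⟨a, rfl⟩ := e.surjective a
      refine ⟨a, w, e.injective ?_⟩
      rw [map_add, map_mul, map_mul, ha]
      ring
    · rintro ⟨a, b, rfl⟩
      refine ⟨Ideal.Quotient.mk _ (e b), ?_⟩
      rw [LinearMap.mulLeft_apply, ← map_mul, eq_comm, Ideal.Quotient.mk_eq_mk_iff_sub_mem,
        Ideal.mem_span_singleton']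
      refine ⟨e a, ?_⟩
      rw [map_add, map_mul, map_mul]
      ring
  exact ((Submodule.Quotient.restrictScalarsEquiv K (Ideal.span {f, g})).symm.trans
    ((Submodule.quotEquivOfEq _ _ hker.symm).trans
      (φ.quotKerEquivOfSurjective hφ))).finrank_eq

end Quotient

section PlaneBranch

open PowerSeries IsLocalRing

variable {K : Type*} [Field K]

lemma PowerSeries.eq_C_add_C_X_mul_add_X_mul (p : K⟦X⟧⟦X⟧) :
    ∃ a b : K⟦X⟧⟦X⟧, p = C (C (constantCoeff (constantCoeff p))) + a * C X + b * X := by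
  refine ⟨C (mk fun i => coeff (i + 1) (constantCoeff p)), mk fun i => coeff (i + 1) p, ?_⟩
  conv_lhs => rw [eq_X_mul_shift_add_const p, eq_X_mul_shift_add_const (constantCoeff p)]
  rw [map_add, map_mul]
  ring

lemma generatesModScalars_quotient (g : K⟦X⟧⟦X⟧) :
    GeneratesModScalars K (Ideal.Quotient.mk (Ideal.span {g}) (C X))
      (Ideal.Quotient.mk (Ideal.span {g}) X) := by
  intro b
  obtain ⟨p, rfl⟩ := Ideal.Quotient.mk_surjective b
  obtain ⟨r, s, hp⟩ := eq_C_add_C_X_mul_add_X_mul p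
  refine ⟨constantCoeff (constantCoeff p), Ideal.Quotient.mk _ r, Ideal.Quotient.mk _ s, ?_⟩
  conv_lhs => rw [hp]
  rw [map_add, map_add, map_mul, map_mul,
    IsScalarTower.algebraMap_apply K K⟦X⟧⟦X⟧ (K⟦X⟧⟦X⟧ ⧸ Ideal.span {g}),
    Ideal.Quotient.algebraMap_eq, PowerSeries.algebraMap_apply,
    PowerSeries.algebraMap_apply, Algebra.algebraMap_self_apply]

lemma mk_mem_filtration_one {g : K⟦X⟧⟦X⟧} (hg : ¬ IsUnit g)
    [IsDomain (K⟦X⟧⟦X⟧ ⧸ Ideal.span {g})] (hB : IsBranchRing K (K⟦X⟧⟦X⟧ ⧸ Ideal.span {g}))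
    {p : K⟦X⟧⟦X⟧} (hp : ¬ IsUnit p) :
    Ideal.Quotient.mk (Ideal.span {g}) p ∈ hB.filtration 1 := by
  intro h0
  have := hB.finite _ h0
  rw [Nat.one_le_iff_ne_zero]
  intro hc
  obtain ⟨b, hb⟩ := (isUnit_of_colength_eq_zero hc).exists_right_inv
  obtain ⟨q, rfl⟩ := Ideal.Quotient.mk_surjective b
  rw [← map_mul, ← map_one (Ideal.Quotient.mk (Ideal.span {g})),
    Ideal.Quotient.mk_eq_mk_iff_sub_mem] at hb
  have hle : Ideal.span {g} ≤ maximalIdeal K⟦X⟧⟦X⟧ := by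
    rwa [Ideal.span_singleton_le_iff_mem, mem_maximalIdeal]
  have h1 : p * q ∈ maximalIdeal K⟦X⟧⟦X⟧ :=
    Ideal.mul_mem_right _ _ ((mem_maximalIdeal p).2 hp)
  have h2 := sub_mem h1 (hle hb)
  rw [sub_sub_cancel] at h2
  exact (mem_maximalIdeal _).1 h2 isUnit_one

lemma exists_colength_eq_one {g : K⟦X⟧⟦X⟧} (hg : Irreducible g)
    (hmap : g.map (residue K⟦X⟧) = 0) :
    ∃ b : K⟦X⟧⟦X⟧ ⧸ Ideal.span {g}, b ≠ 0 ∧ colength K b = 1 := by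
  have hCX : C X ∣ g := by
    refine ⟨mk fun i => mk fun j => coeff (j + 1) (coeff i g), ?_⟩
    ext i : 1
    have hi := congrArg (coeff i) hmap
    rw [coeff_map, map_zero, residue_eq_zero_iff, maximalIdeal_eq_span_X,
      Ideal.mem_span_singleton, X_dvd_iff] at hi
    rw [coeff_C_mul, coeff_mk]
    conv_lhs => rw [eq_X_mul_shift_add_const (coeff i g), hi]
    simp
  have hX : ¬ IsUnit (C X : K⟦X⟧⟦X⟧) := by
    rw [isUnit_iff_constantCoeff, constantCoeff_C]
    exact X_prime.not_isUnit
  obtain ⟨w, hw⟩ := hCX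
  obtain ⟨u, hu⟩ := ((hg.isUnit_or_isUnit hw).resolve_left hX).exists_right_inv
  refine ⟨Ideal.Quotient.mk _ X, ?_, ?_⟩
  · rw [Ne, Ideal.Quotient.eq_zero_iff_mem, Ideal.mem_span_singleton]
    rintro ⟨r, hr⟩
    have := congrArg (map (residue K⟦X⟧)) hr
    rw [map_mul, hmap, zero_mul, map_X] at this
    exact X_ne_zero this
  · let ε : K⟦X⟧⟦X⟧ →ₗ[K] K :=
      { toFun := fun p => constantCoeff (constantCoeff p)
        map_add' := by simp
        map_smul' := by intro a p; rfl }
    have hε : Function.Surjective ε := fun a => ⟨C (C a), by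
      change constantCoeff (constantCoeff (C (C a))) = a
      simp⟩
    have hker : LinearMap.ker ε = (Ideal.span {g, X}).restrictScalars K := by
      ext p
      rw [Submodule.restrictScalars_mem, Ideal.mem_span_pair, LinearMap.mem_ker]
      constructor
      · intro hp
        obtain ⟨r, s, hrs⟩ := eq_C_add_C_X_mul_add_X_mul p
        rw [show constantCoeff (constantCoeff p) = 0 from hp, map_zero, map_zero, zero_add] at hrs
        refine ⟨r * u, s, ?_⟩
        rw [hrs, hw, mul_assoc, mul_comm (C X), ← mul_assoc u, mul_comm u, hu, one_mul]
      · rintro ⟨a, b, rfl⟩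
        change constantCoeff (constantCoeff (a * g + b * X)) = 0
        simp [hw]
    have := finrank_quotient_span_pair (AlgEquiv.refl (R := K)) g X
    rw [AlgEquiv.coe_refl, id, id] at this
    rw [← this, ← Module.finrank_self K]
    exact ((Submodule.Quotient.restrictScalarsEquiv K (Ideal.span {g, X})).symm.trans
      ((Submodule.quotEquivOfEq _ _ hker.symm).trans
        (ε.quotKerEquivOfSurjective hε))).finrank_eq

/-- The lower bound for the conductor, for the quotient of `K⟦X⟧⟦X⟧` by an irreducible series. -/
lemma le_conductor_add_of_irreducible {g : K⟦X⟧⟦X⟧} (hg : Irreducible g) {Γ : Set ℕ}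
    (hΓ : ∀ k, k ∈ Γ ↔ ∃ b : K⟦X⟧⟦X⟧ ⧸ Ideal.span {g}, b ≠ 0 ∧ colength K b = k)
    {c n m : ℕ} (hc : ∀ N, c + N ∈ Γ) (hn : n ∈ Γ) (hn0 : 0 < n)
    (hmin : ∀ k ∈ Γ, 0 < k → n ≤ k) (hm0 : 0 < m) (hm : ∀ k ∈ Γ, k < m → n ∣ k) :
    (n - 1) * m + Nat.gcd n m ≤ c + n := by
  by_cases hmap : g.map (residue K⟦X⟧) = 0
  · have h1 := hmin 1 ((hΓ 1).2 (exists_colength_eq_one hg hmap)) one_pos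
    obtain rfl : n = 1 := by omega
    simp
  have : IsAdicComplete (maximalIdeal K⟦X⟧) K⟦X⟧ := by
    rw [maximalIdeal_eq_span_X]
    infer_instance
  let : Algebra K⟦X⟧ K⟦X⟧⟦X⟧ := MvPowerSeries.instAlgebra
  have : IsScalarTower K K⟦X⟧ K⟦X⟧⟦X⟧ := IsScalarTower.of_algebraMap_eq fun a => by
    rw [PowerSeries.algebraMap_apply, PowerSeries.algebraMap_apply, PowerSeries.algebraMap_apply]
    rfl
  obtain ⟨_, _, hinj⟩ := quotient_span_singleton hg hmap
  have hB : IsBranchRing K (K⟦X⟧⟦X⟧ ⧸ Ideal.span {g}) := isBranchRing_of_finite hinj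
  obtain ⟨b, hb0, rfl⟩ := (hΓ n).1 hn
  have hX : ¬ IsUnit (C X : K⟦X⟧⟦X⟧) := by
    rw [isUnit_iff_constantCoeff, constantCoeff_C]
    exact X_prime.not_isUnit
  exact hB.le_conductor_add (fun N => (hΓ _).1 (hc N)) (generatesModScalars_quotient g)
    (mk_mem_filtration_one hg.not_isUnit hB hX)
    (mk_mem_filtration_one hg.not_isUnit hB X_prime.not_isUnit) hb0 hn0
    (fun k hk hk0 => hmin _ ((hΓ _).2 ⟨k, hk, rfl⟩) hk0) hm0
    (fun k hk hkm => hm _ ((hΓ _).2 ⟨k, hk, rfl⟩) hkm)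

end PlaneBranch

namespace PlaneCurveNote

/-- `K[[x,y]]` as an iterated power series ring in one variable. -/
def iteratedEquiv (K : Type u) [Field K] : PS K ≃ₐ[K] PowerSeries (PowerSeries K) :=
  (MvPowerSeries.renameEquiv K (Fintype.equivOfCardEq (by simp) : Fin 2 ≃ Option Unit)).trans
    (MvPowerSeries.optionEquivLeft Unit K)

lemma mem_valueSemigroup_iff (K : Type u) [Field K] (f : PS K) (n : ℕ) :
    n ∈ valueSemigroup K f ↔
      ∃ b : PowerSeries (PowerSeries K) ⧸ Ideal.span {iteratedEquiv K f},
        b ≠ 0 ∧ colength K b = n := by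
  have hdvd : ∀ g : PS K, f ∣ g ↔
      Ideal.Quotient.mk (Ideal.span {iteratedEquiv K f}) (iteratedEquiv K g) = 0 := fun g => by
    rw [Ideal.Quotient.eq_zero_iff_mem, Ideal.mem_span_singleton, map_dvd_iff]
  constructor
  · rintro ⟨g, hg, rfl⟩
    exact ⟨_, (hdvd g).not.1 hg, (finrank_quotient_span_pair (iteratedEquiv K) f g).symm⟩
  · rintro ⟨b, hb, rfl⟩
    obtain ⟨g, rfl⟩ := Ideal.Quotient.mk_surjective b
    obtain ⟨g, rfl⟩ := (iteratedEquiv K).surjective g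
    exact ⟨g, (hdvd g).not.2 hb, (finrank_quotient_span_pair (iteratedEquiv K) f g).symm⟩

lemma eq_zero_or_le_of_mem_closure {h : ℕ} (hh : 1 ≤ h) {v : Fin (h + 1) → ℕ}
    (hmono : StrictMono v) {k : ℕ} (hk : k ∈ AddSubmonoid.closure (Set.range v)) :
    (k = 0 ∨ v 0 ≤ k) ∧ (v 1 ≤ k ∨ v 0 ∣ k) := by
  induction hk using AddSubmonoid.closure_induction with
  | mem k hk =>
    obtain ⟨i, rfl⟩ := hk
    refine ⟨.inr (hmono.monotone (Fin.zero_le i)), ?_⟩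
    rcases eq_or_ne i 0 with rfl | hi
    · exact .inr dvd_rfl
    · refine .inl (hmono.monotone ?_)
      have : NeZero h := ⟨by omega⟩
      exact Fin.one_le_of_ne_zero hi
  | zero => simp
  | add a b _ _ ha hb =>
    refine ⟨by omega, ?_⟩
    rcases ha.2, hb.2 with ⟨h1 | h1, h2 | h2⟩
    · exact .inl (by omega)
    · exact .inl (by omega)
    · exact .inl (by omega)
    · exact .inr (dvd_add h1 h2)

theorem conductor_lower_bound (K : Type u) [Field K] [IsAlgClosed K]
    (f : PS K) (hf : Irreducible f)
    (h : ℕ) (hh : 1 ≤ h) (v : Fin (h + 1) → ℕ) (hmono : StrictMono v)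
    (hgen : ∀ n : ℕ, n ∈ valueSemigroup K f ↔ n ∈ AddSubmonoid.closure (Set.range v))
    (hmin : ∀ i, v i ∉ AddSubmonoid.closure (v '' {j | j ≠ i}))
    (hgcd : Finset.univ.gcd v = 1)
    (c : ℕ) (hc : c ∈ valueSemigroup K f) (hcN : ∀ N : ℕ, c + N ∈ valueSemigroup K f)
    (hcmin : ∀ c' : ℕ, c' ∈ valueSemigroup K f → (∀ N : ℕ, c' + N ∈ valueSemigroup K f) → c ≤ c') :
    ((v 0 : ℤ) - 1) * ((v 1 : ℤ) - 1) + (Nat.gcd (v 0) (v 1) : ℤ) - 1 ≤ (c : ℤ) ∧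
      ((c : ℤ) = ((v 0 : ℤ) - 1) * ((v 1 : ℤ) - 1) ↔ Nat.gcd (v 0) (v 1) = 1) := by
  have h01 : v 0 < v 1 := hmono (by
    obtain ⟨k, rfl⟩ := Nat.exists_eq_add_of_le' hh
    exact Fin.zero_lt_one)
  have hv0 : 0 < v 0 := by
    rw [Nat.pos_iff_ne_zero]
    intro h0
    apply hmin 0
    rw [h0]
    exact zero_mem _
  have hv1 : 1 < v 0 := by
    by_contra hle
    have h0 : v 0 = 1 := by omega
    refine hmin 1 ?_
    have hmem : v 0 ∈ AddSubmonoid.closure (v '' {j | j ≠ 1}) :=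
      AddSubmonoid.subset_closure ⟨0, fun h => h01.ne (congrArg v h), rfl⟩
    have := nsmul_mem hmem (v 1)
    rwa [h0, smul_eq_mul, mul_one] at this
  have key : (v 0 - 1) * v 1 + Nat.gcd (v 0) (v 1) ≤ c + v 0 := by
    refine le_conductor_add_of_irreducible
      ((MulEquiv.irreducible_iff (iteratedEquiv K)).2 hf) (mem_valueSemigroup_iff K f) hcN
      ((hgen _).2 (AddSubmonoid.subset_closure ⟨0, rfl⟩)) hv0 (fun k hk hk0 => ?_) (by omega)
      (fun k hk hkm => ?_)
    · exact (eq_zero_or_le_of_mem_closure hh hmono ((hgen k).1 hk)).1.resolve_left hk0.ne'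
    · exact (eq_zero_or_le_of_mem_closure hh hmono ((hgen k).1 hk)).2.resolve_left hkm.not_ge
  have hlow : ((v 0 : ℤ) - 1) * ((v 1 : ℤ) - 1) + (Nat.gcd (v 0) (v 1) : ℤ) - 1 ≤ (c : ℤ) := by
    zify [hv0] at key
    linarith
  refine ⟨hlow, fun heq => ?_, fun hcop => ?_⟩
  · have := Nat.gcd_pos_of_pos_left (v 1) hv0
    omega
  · have hfrob := frobeniusNumber_pair hcop hv1 (hv1.trans h01)
    have hle : c ≤ (v 0 - 1) * (v 1 - 1) := by
      have hmem : ∀ N, (v 0 - 1) * (v 1 - 1) + N ∈ valueSemigroup K f := fun N => by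
        rw [hgen]
        by_contra hN
        have hsub : AddSubmonoid.closure {v 0, v 1} ≤ AddSubmonoid.closure (Set.range v) :=
          AddSubmonoid.closure_mono (by rintro _ (rfl | rfl) <;> exact ⟨_, rfl⟩)
        have hN' := hfrob.2 (fun hk => hN (hsub hk))
        obtain ⟨a, ha⟩ : ∃ a, v 0 = a + 1 := ⟨v 0 - 1, by omega⟩
        obtain ⟨b, hb⟩ : ∃ b, v 1 = b + 1 := ⟨v 1 - 1, by omega⟩
        rw [ha, hb, Nat.add_sub_cancel, Nat.add_sub_cancel,
          show (a + 1) * (b + 1) = a * b + (a + b + 1) by ring] at hN'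
        have := Nat.mul_pos (show 0 < a by omega) (show 0 < b by omega)
        omega
      exact hcmin _ (hmem 0) hmem
    zify [hv0, hv0.trans h01] at hle
    rw [hcop] at hlow
    push_cast at hlow
    linarith

end PlaneCurveNote
end
end

section
/- Let f ∈ K[[x,y]] (K algebraically closed) be an elementary power series of bidegree (m,n) and let d = gcd(m,n). Then In f(x,y) = F(x^{m/d}, y^{n/d}) where F = F(u,v) is a homogeneous form of degree d. Moreover, if f is irreducible then In f(x,y) = (a x^{m/d} + b y^{n/d})^d for some a, b ∈ K. -/
/-!
Common definitions for formalizing "A note on the plane curve singularities in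
positive characteristic" by E. García Barroso and A. Płoski.

We work with the ring `K[[x,y]] := MvPowerSeries (Fin 2) K`, where `x` is the
variable of index `0` and `y` the variable of index `1`.
-/

open scoped Classical

noncomputable section

universe u

namespace PlaneCurveNote

variable (K : Type u) [Field K]

section Auxiliary

open Polynomial

/-- Graded Hensel lifting: a factorization of the lowest coefficient of a power series lifts to a
factorization of the whole series, provided that the linearized equation is solvable in each
degree. -/
theorem exists_mul_eq_of_graded {R : Type*} [CommRing R] (V : ℕ → AddSubgroup R)
    (hmul : ∀ {k l : ℕ} {a b : R}, a ∈ V k → b ∈ V l → a * b ∈ V (k + l))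
    {E E' : ℕ} {g h : R} (hg : g ∈ V E) (hh : h ∈ V E')
    (hsolve : ∀ j, ∀ r ∈ V (E + E' + j), ∃ a ∈ V (E + j), ∃ b ∈ V (E' + j), r = a * h + g * b)
    (φ : PowerSeries R) (hφ : ∀ j, PowerSeries.coeff j φ ∈ V (E + E' + j))
    (hφ0 : PowerSeries.coeff 0 φ = g * h) :
    ∃ γ η : PowerSeries R, (∀ j, PowerSeries.coeff j γ ∈ V (E + j)) ∧
      (∀ j, PowerSeries.coeff j η ∈ V (E' + j)) ∧ γ * η = φ := by
  have hsolve' : ∀ j r, ∃ s : R × R, r ∈ V (E + E' + j) →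
      s.1 ∈ V (E + j) ∧ s.2 ∈ V (E' + j) ∧ r = s.1 * h + g * s.2 := by
    intro j r
    by_cases hr : r ∈ V (E + E' + j)
    · obtain ⟨a, ha, b, hb, e⟩ := hsolve j r hr
      exact ⟨(a, b), fun _ => ⟨ha, hb, e⟩⟩
    · exact ⟨0, fun h => absurd h hr⟩
  choose σ hσ using hsolve'
  let F : ∀ N : ℕ, (∀ k : ℕ, k < N → R × R) → R × R := fun N rec =>
    if N = 0 then (g, h) else
      σ N (PowerSeries.coeff N φ - ∑ p ∈ Finset.HasAntidiagonal.antidiagonal N,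
        if hp : p.1 < N ∧ p.2 < N then (rec p.1 hp.1).1 * (rec p.2 hp.2).2 else 0)
  let s : ℕ → R × R := WellFounded.fix Nat.lt_wfRel.wf F
  have hs : ∀ N, s N = F N (fun k _ => s k) := fun N => WellFounded.fix_eq _ _ _
  have hs0 : s 0 = (g, h) := by rw [hs]; simp [F]
  have hsN : ∀ N, N ≠ 0 → s N = σ N (PowerSeries.coeff N φ - ∑ p ∈ Finset.HasAntidiagonal.antidiagonal N,
        if p.1 < N ∧ p.2 < N then (s p.1).1 * (s p.2).2 else 0) := by
    intro N hN
    rw [hs]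
    simp only [F, if_neg hN, dite_eq_ite]
  have hmem : ∀ N, (s N).1 ∈ V (E + N) ∧ (s N).2 ∈ V (E' + N) ∧
      (N ≠ 0 → PowerSeries.coeff N φ - (∑ p ∈ Finset.HasAntidiagonal.antidiagonal N,
        if p.1 < N ∧ p.2 < N then (s p.1).1 * (s p.2).2 else 0) =
          (s N).1 * h + g * (s N).2) := by
    intro N
    induction N using Nat.strong_induction_on with
    | _ N ih =>
      rcases eq_or_ne N 0 with rfl | hN
      · rw [hs0]
        exact ⟨hg, hh, fun h => absurd rfl h⟩
      · have key := hσ N (PowerSeries.coeff N φ - ∑ p ∈ Finset.HasAntidiagonal.antidiagonal N,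
          if p.1 < N ∧ p.2 < N then (s p.1).1 * (s p.2).2 else 0) (by
            refine sub_mem (hφ N) (sum_mem fun p hp => ?_)
            split_ifs with h'
            · have := hmul (ih _ h'.1).1 (ih _ h'.2).2.1
              rw [Finset.HasAntidiagonal.mem_antidiagonal] at hp
              rwa [show E + p.1 + (E' + p.2) = E + E' + N by omega] at this
            · exact zero_mem _)
        rw [← hsN N hN] at key
        exact ⟨key.1, key.2.1, fun _ => key.2.2⟩
  refine ⟨PowerSeries.mk fun N => (s N).1, PowerSeries.mk fun N => (s N).2,
    fun j => by simpa using (hmem j).1, fun j => by simpa using (hmem j).2.1, ?_⟩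
  ext N
  rw [PowerSeries.coeff_mul]
  simp only [PowerSeries.coeff_mk]
  rcases eq_or_ne N 0 with rfl | hN
  · simp only [Finset.HasAntidiagonal.antidiagonal_zero, Finset.sum_singleton, hs0, hφ0]
  · have key := (hmem N).2.2 hN
    have split : ∑ p ∈ Finset.HasAntidiagonal.antidiagonal N, (s p.1).1 * (s p.2).2 =
        (∑ p ∈ Finset.HasAntidiagonal.antidiagonal N,
          if p.1 < N ∧ p.2 < N then (s p.1).1 * (s p.2).2 else 0) +
        ((∑ p ∈ Finset.HasAntidiagonal.antidiagonal N, if p = (N, 0) then (s p.1).1 * (s p.2).2 else 0) +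
        ∑ p ∈ Finset.HasAntidiagonal.antidiagonal N, if p = (0, N) then (s p.1).1 * (s p.2).2 else 0) := by
      rw [← Finset.sum_add_distrib, ← Finset.sum_add_distrib]
      refine Finset.sum_congr rfl fun p hp => ?_
      obtain ⟨p, q⟩ := p
      rw [Finset.HasAntidiagonal.mem_antidiagonal] at hp
      simp only [Prod.mk.injEq] at hp ⊢
      rcases Nat.eq_zero_or_pos p with rfl | hp0
      · have : q = N := by omega
        subst this
        simp [hN, Ne.symm hN]
      · rcases Nat.eq_zero_or_pos q with rfl | hq0
        · have : p = N := by omega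
          subst this
          simp [hN]
        · have h1 : p < N ∧ q < N := by omega
          have h2 : ¬ (p = N ∧ q = 0) := by omega
          have h3 : ¬ (p = 0 ∧ q = N) := by omega
          rw [if_pos h1, if_neg h2, if_neg h3, add_zero, add_zero]
    rw [split, Finset.sum_ite_eq' _ (N, 0), Finset.sum_ite_eq' _ (0, N)]
    simp only [Finset.HasAntidiagonal.mem_antidiagonal, add_zero, zero_add, if_true, hs0]
    rw [← key]
    ring

/-- The polynomials in `z` obtained from the polynomials in `x, y` that are weighted homogeneous
of degree `k` for the weights `a, b` by setting `x = 1`, `y = z`. -/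
def weightSlice (R : Type*) [CommRing R] (a b k : ℕ) : AddSubgroup R[X] where
  carrier := {P | ∀ j, P.coeff j ≠ 0 → ∃ i, a * i + b * j = k}
  zero_mem' := by simp
  add_mem' := by
    intro P Q hP hQ j hj
    by_cases h : P.coeff j = 0
    · exact hQ j (by simpa [h] using hj)
    · exact hP j h
  neg_mem' := by
    intro P hP j hj
    exact hP j (by simpa using hj)

theorem mul_mem_weightSlice {R : Type*} [CommRing R] {a b k l : ℕ} {P Q : R[X]}
    (hP : P ∈ weightSlice R a b k) (hQ : Q ∈ weightSlice R a b l) :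
    P * Q ∈ weightSlice R a b (k + l) := by
  intro j hj
  rw [coeff_mul] at hj
  obtain ⟨p, hp, hne⟩ := Finset.exists_ne_zero_of_sum_ne_zero hj
  obtain ⟨i, hi⟩ := hP p.1 (left_ne_zero_of_mul hne)
  obtain ⟨i', hi'⟩ := hQ p.2 (right_ne_zero_of_mul hne)
  rw [Finset.HasAntidiagonal.mem_antidiagonal] at hp
  exact ⟨i + i', by rw [← hi, ← hi', ← hp]; ring⟩

theorem X_pow_mul_expand_mem_weightSlice {R : Type*} [CommRing R] {a b k j r : ℕ} (ha : 0 < a)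
    {q : R[X]} (hq : q.natDegree ≤ r) (hk : ∃ i, a * i + b * j + a * b * r = k) :
    X ^ j * expand R a q ∈ weightSlice R a b k := by
  obtain ⟨i, rfl⟩ := hk
  intro l hl
  rw [coeff_X_pow_mul', coeff_expand ha] at hl
  split_ifs at hl with h1 h2
  · obtain ⟨t, ht⟩ := h2
    rw [ht, Nat.mul_div_cancel_left _ ha] at hl
    have htr : t ≤ r := (le_natDegree_of_ne_zero hl).trans hq
    obtain ⟨u, rfl⟩ := Nat.exists_eq_add_of_le htr
    obtain rfl : l = j + a * t := by omega
    exact ⟨i + b * u, by ring⟩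
  · exact absurd rfl hl
  · exact absurd rfl hl

/-- An element of the weight slice is `z ^ j q(z ^ a)` with `j < a` and `deg q` bounded. -/
theorem exists_eq_X_pow_mul_expand {R : Type*} [CommRing R] {a b k : ℕ} (ha : 0 < a) (hb : 0 < b)
    (hab : Nat.Coprime a b) {P : R[X]} (hP : P ∈ weightSlice R a b k) (hP0 : P ≠ 0) :
    ∃ (j r i : ℕ) (q : R[X]), j < a ∧ i < b ∧ a * i + b * j + a * b * r = k ∧
      q.natDegree ≤ r ∧ P = X ^ j * expand R a q := by
  obtain ⟨j', hj'⟩ : ∃ j, P.coeff j ≠ 0 := by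
    by_contra! h
    exact hP0 (Polynomial.ext (by simpa using h))
  obtain ⟨i', hi'⟩ := hP j' hj'
  set I := i' + b * (j' / a) with hI
  set j := j' % a
  set i := I % b
  set r := I / b
  have hja : j < a := Nat.mod_lt _ ha
  have hib : i < b := Nat.mod_lt _ hb
  have hk : a * i + b * j + a * b * r = k := by
    have h1 : j + a * (j' / a) = j' := Nat.mod_add_div _ _
    have h2 : i + b * r = I := Nat.mod_add_div _ _
    calc a * i + b * j + a * b * r = a * (i + b * r) + b * j := by ring
      _ = a * i' + b * (j + a * (j' / a)) := by rw [h2, hI]; ring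
      _ = k := by rw [h1, hi']
  have hcoeff : ∀ l, (∑ t ∈ Finset.range (r + 1), monomial t (P.coeff (j + a * t))).coeff l =
      if l < r + 1 then P.coeff (j + a * l) else 0 := by
    intro l
    simp [coeff_monomial]
  refine ⟨j, r, i, ∑ t ∈ Finset.range (r + 1), monomial t (P.coeff (j + a * t)), hja, hib, hk,
    ?_, ?_⟩
  · refine natDegree_le_iff_coeff_eq_zero.2 fun l hl => ?_
    rw [hcoeff, if_neg (by omega)]
  · ext l
    rw [coeff_X_pow_mul', coeff_expand ha, hcoeff]
    by_cases hl : P.coeff l = 0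
    · rw [hl]
      split_ifs with h1 h2 h3
      · rw [Nat.mul_div_cancel' h2, Nat.add_sub_cancel' h1, hl]
      all_goals rfl
    · obtain ⟨i₂, hi₂⟩ := hP l hl
      have hmod : b * j ≡ b * l [MOD a] := by
        have : b * j + a * (i + b * r) = b * l + a * i₂ := by
          rw [← hk] at hi₂
          linarith
        have h3 : b * j + a * (i + b * r) ≡ b * l + a * i₂ [MOD a] := by rw [this]
        simpa [Nat.ModEq] using h3
      have hmod' : j ≡ l [MOD a] := Nat.ModEq.cancel_left_of_coprime hab hmod
      have hjl : j ≤ l := by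
        have : j % a = l % a := hmod'
        rw [Nat.mod_eq_of_lt hja] at this
        exact this ▸ Nat.mod_le _ _
      obtain ⟨t, ht⟩ := (Nat.modEq_iff_dvd' hjl).1 hmod'
      obtain rfl : l = j + a * t := by omega
      have htr : t < r + 1 := by
        have : (a * b) * t < (a * b) * (r + 1) := by nlinarith
        exact lt_of_mul_lt_mul_left this (Nat.zero_le _)
      simp [ht, Nat.mul_div_cancel_left _ ha, htr]

/-- Bézout with degree bounds. -/
theorem exists_eq_mul_add_mul_of_isCoprime {F : Type*} [Field F] {g h p : F[X]} (hg : g.Monic)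
    (hcop : IsCoprime g h) {e e' r : ℕ} (he : g.natDegree = e) (he0 : 0 < e)
    (he' : h.natDegree ≤ e') (he0' : 0 < e') (hr : e + e' ≤ r + 1) (hp : p.natDegree ≤ r) :
    ∃ u v : F[X], u.natDegree + e' ≤ r ∧ v.natDegree + e ≤ r ∧ p = u * h + g * v := by
  obtain ⟨A, B, hAB⟩ := hcop
  have hu : ((p * B) %ₘ g).natDegree < e := by
    rw [← he]
    refine natDegree_modByMonic_lt _ hg fun h1 => ?_
    rw [h1, natDegree_one] at he
    omega
  obtain ⟨v, hv⟩ : g ∣ p - (p * B) %ₘ g * h := by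
    refine ⟨p * A + ((p * B) /ₘ g) * h, ?_⟩
    have h1 := modByMonic_add_div (p * B) g
    linear_combination (-p) * hAB - h * h1
  refine ⟨(p * B) %ₘ g, v, by omega, ?_, by rw [← hv]; ring⟩
  have hdeg : (g * v).natDegree ≤ r := by
    rw [← hv]
    refine (natDegree_sub_le _ _).trans (max_le hp (natDegree_mul_le.trans ?_))
    omega
  rcases eq_or_ne v 0 with rfl | hv0
  · simp; omega
  · rw [hg.natDegree_mul' hv0, he] at hdeg
    omega

/-- Solvability of the linearized factorization equation in each weight slice. -/
theorem exists_mem_weightSlice_eq {F : Type*} [Field F] {a b : ℕ} (ha : 0 < a) (hb : 0 < b)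
    (hab : Nat.Coprime a b) {g h : F[X]} (hg : g.Monic) (hcop : IsCoprime g h) {e e' : ℕ}
    (he : g.natDegree = e) (he0 : 0 < e) (he' : h.natDegree ≤ e') (he0' : 0 < e') (j : ℕ)
    (P : F[X]) (hP : P ∈ weightSlice F a b (a * b * e + a * b * e' + j)) :
    ∃ u ∈ weightSlice F a b (a * b * e + j), ∃ v ∈ weightSlice F a b (a * b * e' + j),
      P = u * expand F a h + expand F a g * v := by
  rcases eq_or_ne P 0 with rfl | hP0
  · exact ⟨0, zero_mem _, 0, zero_mem _, by simp⟩
  obtain ⟨l, r, i, p, hla, hib, hk, hpr, rfl⟩ := exists_eq_X_pow_mul_expand ha hb hab hP hP0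
  have hr : e + e' ≤ r + 1 := by
    have : (a * b) * (e + e') < (a * b) * (r + 2) := by nlinarith
    have := lt_of_mul_lt_mul_left this (Nat.zero_le _)
    omega
  obtain ⟨u, v, hu, hv, rfl⟩ := exists_eq_mul_add_mul_of_isCoprime hg hcop he he0 he' he0' hr hpr
  refine ⟨X ^ l * expand F a u, ?_, X ^ l * expand F a v, ?_, by simp only [map_add, map_mul]; ring⟩
  · obtain ⟨s, rfl⟩ := Nat.exists_eq_add_of_le (show e' ≤ r by omega)
    refine X_pow_mul_expand_mem_weightSlice (r := s) ha (by omega) ⟨i, ?_⟩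
    nlinarith
  · obtain ⟨s, rfl⟩ := Nat.exists_eq_add_of_le (show e ≤ r by omega)
    refine X_pow_mul_expand_mem_weightSlice (r := s) ha (by omega) ⟨i, ?_⟩
    nlinarith

variable {K}

/-- The power series `f(t ^ a, t ^ b z)` in `t` with coefficients in `K[z]`. -/
def weightSeries (a b : ℕ) (f : PS K) : PowerSeries K[X] :=
  PowerSeries.mk fun k => ∑ β ∈ Finset.range (k + 1),
    if b * β ≤ k ∧ a ∣ k - b * β then monomial β (coef K f ((k - b * β) / a, β)) else 0

/-- The inverse of `weightSeries a b`. -/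
def ofWeightSeries (a b : ℕ) (Γ : PowerSeries K[X]) : PS K :=
  ofCoef K fun p => (PowerSeries.coeff (a * p.1 + b * p.2) Γ).coeff p.2

theorem coeff_coeff_weightSeries {a b : ℕ} (hb : 0 < b) (f : PS K) (k β : ℕ) :
    (PowerSeries.coeff k (weightSeries a b f)).coeff β =
      if b * β ≤ k ∧ a ∣ k - b * β then coef K f ((k - b * β) / a, β) else 0 := by
  rw [weightSeries, PowerSeries.coeff_mk, finsetSum_coeff]
  rw [Finset.sum_eq_single β]
  · split_ifs <;> simp
  · intro l _ hl
    split_ifs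
    · rw [coeff_monomial, if_neg hl]
    · rfl
  · intro h
    rw [if_neg, coeff_zero]
    rintro ⟨h1, -⟩
    rw [Finset.mem_range] at h
    nlinarith

theorem coeff_coeff_weightSeries_add {a b : ℕ} (ha : 0 < a) (hb : 0 < b) (f : PS K) (α β : ℕ) :
    (PowerSeries.coeff (a * α + b * β) (weightSeries a b f)).coeff β = coef K f (α, β) := by
  rw [coeff_coeff_weightSeries hb, Nat.add_sub_cancel, Nat.mul_div_cancel_left _ ha,
    if_pos ⟨Nat.le_add_left _ _, Dvd.intro _ rfl⟩]

theorem coeff_weightSeries_mem {a b : ℕ} (hb : 0 < b) (f : PS K) (k : ℕ) :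
    PowerSeries.coeff k (weightSeries a b f) ∈ weightSlice K a b k := by
  intro j hj
  rw [coeff_coeff_weightSeries hb] at hj
  split_ifs at hj with h
  · obtain ⟨i, hi⟩ := h.2
    exact ⟨i, by omega⟩
  · exact absurd rfl hj

theorem coeff_eq_coef (f : PS K) (e : Fin 2 →₀ ℕ) :
    MvPowerSeries.coeff e f = coef K f (e 0, e 1) := by
  have h : e = Finsupp.single 0 (e 0) + Finsupp.single 1 (e 1) := by
    ext i
    fin_cases i <;> simp
  rw [coef, ← h]

theorem coeff_ofCoef (c : ℕ × ℕ → K) (e : Fin 2 →₀ ℕ) :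
    MvPowerSeries.coeff e (ofCoef K c) = c (e 0, e 1) := rfl

theorem ofWeightSeries_weightSeries {a b : ℕ} (ha : 0 < a) (hb : 0 < b) (f : PS K) :
    ofWeightSeries a b (weightSeries a b f) = f := by
  ext e
  rw [ofWeightSeries, coeff_ofCoef, coeff_coeff_weightSeries_add ha hb, coeff_eq_coef]

theorem ofWeightSeries_mul {a b : ℕ} (ha : 0 < a) {Γ H : PowerSeries K[X]}
    (hΓ : ∀ k, PowerSeries.coeff k Γ ∈ weightSlice K a b k)
    (hH : ∀ k, PowerSeries.coeff k H ∈ weightSlice K a b k) :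
    ofWeightSeries a b (Γ * H) = ofWeightSeries a b Γ * ofWeightSeries a b H := by
  ext e
  rw [MvPowerSeries.coeff_mul]
  simp only [ofWeightSeries, coeff_ofCoef, PowerSeries.coeff_mul, finsetSum_coeff, coeff_mul]
  rw [← Finset.sum_product']
  symm
  refine Finset.sum_of_injOn
    (fun p => ((a * p.1 0 + b * p.1 1, a * p.2 0 + b * p.2 1), (p.1 1, p.2 1))) ?_ ?_ ?_ ?_
  · rintro ⟨u, v⟩ - ⟨u', v'⟩ - h
    simp only [Prod.mk.injEq] at h
    obtain ⟨⟨h1, h2⟩, h3, h4⟩ := h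
    rw [h3] at h1
    rw [h4] at h2
    have h5 : u 0 = u' 0 := Nat.eq_of_mul_eq_mul_left ha (by omega)
    have h6 : v 0 = v' 0 := Nat.eq_of_mul_eq_mul_left ha (by omega)
    ext i <;> fin_cases i <;> assumption
  · rintro ⟨u, v⟩ h
    simp only [Finset.mem_coe, Finset.HasAntidiagonal.mem_antidiagonal, Finset.mem_product] at h ⊢
    rw [← h]
    simp only [Finsupp.add_apply]
    exact ⟨by ring, trivial⟩
  · rintro ⟨⟨k, l⟩, ⟨c, c'⟩⟩ hmem himg
    by_contra hne
    apply himg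
    obtain ⟨i, hi⟩ := hΓ k c (left_ne_zero_of_mul hne)
    obtain ⟨i', hi'⟩ := hH l c' (right_ne_zero_of_mul hne)
    simp only [Finset.HasAntidiagonal.mem_antidiagonal, Finset.mem_product] at hmem
    refine ⟨(Finsupp.single 0 i + Finsupp.single 1 c, Finsupp.single 0 i' + Finsupp.single 1 c'),
      ?_, by simp [hi, hi']⟩
    have h0 : i + i' = e 0 := Nat.eq_of_mul_eq_mul_left ha (by
      have := hmem.1
      rw [← hi, ← hi', ← hmem.2] at this
      linarith)
    simp only [Finset.mem_coe, Finset.HasAntidiagonal.mem_antidiagonal]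
    ext t
    fin_cases t
    · simpa using h0
    · simpa using hmem.2
  · rintro ⟨u, v⟩ -
    rfl

theorem coeff_X_pow_mul_mem {V : ℕ → AddSubgroup K[X]} {E : ℕ} {γ : PowerSeries K[X]}
    (hγ : ∀ j, PowerSeries.coeff j γ ∈ V (E + j)) (k : ℕ) :
    PowerSeries.coeff k (PowerSeries.X ^ E * γ) ∈ V k := by
  rw [PowerSeries.coeff_X_pow_mul']
  split_ifs with h
  · obtain ⟨j, rfl⟩ := Nat.exists_eq_add_of_le h
    simpa using hγ j
  · exact zero_mem _

theorem not_isUnit_ofWeightSeries (a b : ℕ) {E : ℕ} (hE : 0 < E) (γ : PowerSeries K[X]) :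
    ¬ IsUnit (ofWeightSeries a b (PowerSeries.X ^ E * γ)) := by
  intro h
  have h1 := MvPowerSeries.isUnit_constantCoeff _ h
  rw [← MvPowerSeries.coeff_zero_eq_constantCoeff_apply, ofWeightSeries, coeff_ofCoef,
    PowerSeries.coeff_X_pow_mul', if_neg (by simp; omega)] at h1
  simp at h1

/-- A series whose initial form splits into coprime factors of positive degree is reducible. -/
theorem not_irreducible_of_isCoprime {a b : ℕ} (ha : 0 < a) (hb : 0 < b) (hab : Nat.Coprime a b)
    {f : PS K} {g h : K[X]} (hg : g.Monic) (hcop : IsCoprime g h) {e e' : ℕ}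
    (he : g.natDegree = e) (he0 : 0 < e) (he' : h.natDegree ≤ e') (he0' : 0 < e')
    (hf : ∀ p ∈ supp K f, a * b * (e + e') ≤ a * p.1 + b * p.2)
    (hin : PowerSeries.coeff (a * b * (e + e')) (weightSeries a b f) = expand K a (g * h)) :
    ¬ Irreducible f := by
  rw [mul_add] at hf hin
  obtain ⟨φ, hφ⟩ : PowerSeries.X ^ (a * b * e + a * b * e') ∣ weightSeries a b f := by
    rw [PowerSeries.X_pow_dvd_iff]
    intro k hk
    ext β
    rw [coeff_coeff_weightSeries hb, coeff_zero]
    split_ifs with h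
    · by_contra hne
      have := hf _ hne
      obtain ⟨i, hi⟩ := h.2
      simp only [hi, Nat.mul_div_cancel_left _ ha] at this
      omega
    · rfl
  have hφc : ∀ j, PowerSeries.coeff j φ =
      PowerSeries.coeff (a * b * e + a * b * e' + j) (weightSeries a b f) := by
    intro j
    rw [hφ, add_comm _ j, PowerSeries.coeff_X_pow_mul]
  have hmem : ∀ (q : K[X]) (c : ℕ), q.natDegree ≤ c → expand K a q ∈ weightSlice K a b (a * b * c) :=
    fun q c hq => by
      simpa using X_pow_mul_expand_mem_weightSlice (j := 0) ha hq ⟨0, by simp⟩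
  obtain ⟨γ, η, hγ, hη, hmul⟩ := exists_mul_eq_of_graded (weightSlice K a b) mul_mem_weightSlice
    (hmem g e he.le) (hmem h e' he')
    (exists_mem_weightSlice_eq ha hb hab hg hcop he he0 he' he0') φ
    (fun j => by rw [hφc]; exact coeff_weightSeries_mem hb f _)
    (by rw [hφc, add_zero, hin, map_mul])
  intro hirr
  have hfac : f = ofWeightSeries a b (PowerSeries.X ^ (a * b * e) * γ) *
      ofWeightSeries a b (PowerSeries.X ^ (a * b * e') * η) := by
    rw [← ofWeightSeries_mul ha (coeff_X_pow_mul_mem hγ) (coeff_X_pow_mul_mem hη)]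
    rw [mul_mul_mul_comm, ← pow_add, hmul, ← hφ, ofWeightSeries_weightSeries ha hb]
  rcases hirr.isUnit_or_isUnit hfac with hu | hu
  · exact not_isUnit_ofWeightSeries a b (by positivity) γ hu
  · exact not_isUnit_ofWeightSeries a b (by positivity) η hu

/-- The vertex of a planar set on the second axis starts an edge of its Newton polygon. -/
theorem exists_edge_of_vertex {s : Set (ℕ × ℕ)} {m n : ℕ} (hn : 0 < n)
    (hmin : ∀ b, (0, b) ∈ s → n ≤ b) (hm : (m, 0) ∈ s) :
    ∃ p ∈ s, 0 < p.1 ∧ p.2 < n ∧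
      (∀ q ∈ s, p.1 * n ≤ (n - p.2) * q.1 + p.1 * q.2) ∧
      (∀ q ∈ s, (n - p.2) * q.1 + p.1 * q.2 = p.1 * n → q.1 ≤ p.1 ∧ p.2 ≤ q.2) := by
  have hpos : ∀ q ∈ s, q.2 < n → 0 < q.1 := by
    rintro ⟨q1, q2⟩ hq hlt
    rcases Nat.eq_zero_or_pos q1 with rfl | h
    · exact absurd (hmin _ hq) (by simpa using hlt)
    · exact h
  -- The slope `q.1 / (n - q.2)` with a common denominator, ties being broken by `q.2`.
  let slope : ℕ × ℕ → ℕ := fun q => q.1 * (n.factorial / (n - q.2)) * n + q.2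
  obtain ⟨p, ⟨hps, hpn⟩, hp⟩ := exists_minimalFor_of_wellFoundedLT
    (fun q => q ∈ s ∧ q.2 < n) slope ⟨(m, 0), hm, hn⟩
  have hp' : ∀ q ∈ s, q.2 < n → slope p ≤ slope q := fun q hq hqn => by
    rcases le_total (slope p) (slope q) with h | h
    · exact h
    · exact hp ⟨hq, hqn⟩ h
  have hdvd : ∀ q : ℕ × ℕ, q.2 < n → (n - q.2) * (n.factorial / (n - q.2)) = n.factorial :=
    fun q hq => Nat.mul_div_cancel' (Nat.dvd_factorial (by omega) (by omega))
  have hle : ∀ q ∈ s, q.2 < n → p.1 * (n - q.2) ≤ (n - p.2) * q.1 ∧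
      ((n - p.2) * q.1 = p.1 * (n - q.2) → p.2 ≤ q.2) := by
    intro q hq hqn
    have h1 := hp' q hq hqn
    simp only [slope] at h1
    have hP := hdvd p hpn
    have hQ := hdvd q hqn
    set P := n.factorial / (n - p.2)
    set Q := n.factorial / (n - q.2)
    have hPQ : p.1 * P ≤ q.1 * Q := by
      by_contra! hlt
      have : (q.1 * Q + 1) * n ≤ p.1 * P * n := Nat.mul_le_mul_right _ hlt
      nlinarith
    have hfac := n.factorial_pos
    have e1 : n.factorial * (p.1 * (n - q.2)) = (p.1 * P) * ((n - p.2) * (n - q.2)) := by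
      rw [← hP]; ring
    have e2 : n.factorial * ((n - p.2) * q.1) = (q.1 * Q) * ((n - p.2) * (n - q.2)) := by
      rw [← hQ]; ring
    refine ⟨le_of_mul_le_mul_left (a := n.factorial) ?_ hfac, fun heq => ?_⟩
    · rw [e1, e2]
      exact Nat.mul_le_mul_right _ hPQ
    · rw [heq, e1] at e2
      have : p.1 * P = q.1 * Q := Nat.eq_of_mul_eq_mul_right
        (Nat.mul_pos (by omega) (by omega)) e2
      rw [this] at h1
      omega
  have hp0 := hpos p hps hpn
  refine ⟨p, hps, hp0, hpn, fun q hq => ?_, fun q hq heq => ?_⟩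
  · rcases lt_or_ge q.2 n with hqn | hqn
    · have := (hle q hq hqn).1
      obtain ⟨t, ht⟩ := Nat.exists_eq_add_of_le hqn.le
      rw [show n - q.2 = t by omega] at this
      calc p.1 * n = p.1 * t + p.1 * q.2 := by rw [ht]; ring
        _ ≤ _ := by omega
    · exact (Nat.mul_le_mul_left _ hqn).trans (Nat.le_add_left _ _)
  · rcases lt_or_ge q.2 n with hqn | hqn
    · obtain ⟨t, ht⟩ := Nat.exists_eq_add_of_le hqn.le
      have heq' : (n - p.2) * q.1 = p.1 * (n - q.2) := by
        rw [show n - q.2 = t by omega]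
        have : p.1 * n = p.1 * t + p.1 * q.2 := by rw [ht]; ring
        omega
      have h2 := (hle q hq hqn).2 heq'
      refine ⟨?_, h2⟩
      refine le_of_mul_le_mul_left (a := n - p.2) ?_ (by omega)
      rw [heq', mul_comm]
      exact Nat.mul_le_mul_right _ (by omega)
    · have : (n - p.2) * q.1 = 0 := by
        have := Nat.mul_le_mul_left p.1 hqn
        omega
      rcases Nat.mul_eq_zero.1 this with h | h
      · omega
      · exact ⟨by omega, by omega⟩

/-- The edge of an elementary series joins `(0, n)` to `(m, 0)`. -/
theorem edge_of_newtonPolygon_eq_singleton {f : PS K} (hconv : Convenient K f) {S : NEdge}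
    (hS : newtonPolygon K f = {S}) :
    S.A = (0, ordY K f) ∧ S.B = (ordX K f, 0) ∧
      ∀ q ∈ supp K f, ordX K f * ordY K f ≤ ordY K f * q.1 + ordX K f * q.2 := by
  have hm : (ordX K f, 0) ∈ supp K f := Nat.sInf_mem hconv.1
  have hn : (0, ordY K f) ∈ supp K f := Nat.sInf_mem hconv.2
  have hm' : ∀ a, (a, 0) ∈ supp K f → ordX K f ≤ a := fun a ha => Nat.sInf_le ha
  have hn' : ∀ b, (0, b) ∈ supp K f → ordY K f ≤ b := fun b hb => Nat.sInf_le hb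
  have hSmem : S ∈ newtonPolygon K f := by rw [hS]; rfl
  have h0 : (0, 0) ∉ supp K f := by
    intro h
    obtain ⟨-, -, w, -, hw2, -, hmin, -⟩ := hSmem
    have h1 := hmin _ h
    have h2 : 0 < S.A.2 := (Nat.zero_le _).trans_lt S.hy
    have := Nat.mul_pos hw2 h2
    simp only [mul_zero, add_zero] at h1
    omega
  set m := ordX K f
  set n := ordY K f
  have hm0 : 0 < m := Nat.pos_of_ne_zero fun h => h0 (h ▸ hm)
  have hn0 : 0 < n := Nat.pos_of_ne_zero fun h => h0 (h ▸ hn)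
  obtain ⟨p, hps, hp1, hpn, hle, heq⟩ := exists_edge_of_vertex hn0 hn' hm
  obtain ⟨q, hqs, hq1, hqm, hle', heq'⟩ :=
    exists_edge_of_vertex (s := Prod.swap ⁻¹' supp K f) hm0 hm' hn
  have hA : (⟨(0, n), p, hp1, hpn⟩ : NEdge) = S := by
    rw [← Set.mem_singleton_iff, ← hS]
    refine ⟨hn, hps, (n - p.2, p.1), by simpa using hpn, hp1, ?_, fun r hr => ?_,
      fun r hr h => ⟨Nat.zero_le _, ?_⟩⟩
    · obtain ⟨t, ht⟩ := Nat.exists_eq_add_of_le hpn.le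
      simp only [ht, Nat.add_sub_cancel_left]
      ring
    · simpa using hle r hr
    · exact (heq r hr (by simpa using h)).1
  have hB : (⟨q.swap, (m, 0), hqm, hq1⟩ : NEdge) = S := by
    rw [← Set.mem_singleton_iff, ← hS]
    have hval : q.1 * m = q.1 * q.2 + (m - q.2) * q.1 := by
      obtain ⟨t, ht⟩ := Nat.exists_eq_add_of_le hqm.le
      rw [show m - q.2 = t by omega, ht]
      ring
    refine ⟨hqs, hm, (q.1, m - q.2), hq1, by simpa using hqm, ?_, fun r hr => ?_,
      fun r hr h => ?_⟩
    · simpa using hval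
    · have := hle' r.swap (by simpa using hr)
      simp only [Prod.fst_swap, Prod.snd_swap] at this ⊢
      omega
    · simp only [Prod.fst_swap, Prod.snd_swap] at h ⊢
      have := (heq' r.swap (by simpa using hr) (by
        simp only [Prod.fst_swap, Prod.snd_swap]; omega)).2
      refine ⟨by simpa using this, ?_⟩
      refine le_of_mul_le_mul_left (a := q.1) ?_ hq1
      show q.1 * r.1 ≤ q.1 * m
      omega
  have hSA : S.A = (0, n) := by rw [← hA]
  have hq : q = (n, 0) := by
    rw [← hB] at hSA
    simpa [Prod.swap] using congrArg Prod.swap hSA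
  refine ⟨hSA, by rw [← hB], fun r hr => ?_⟩
  have := hle' r.swap (by simpa using hr)
  rw [hq] at this
  simp only [Prod.fst_swap, Prod.snd_swap, Nat.sub_zero] at this
  rw [mul_comm m n]
  omega

/-- The lattice points `(i, j)` with `a i + b j = a b d`. -/
theorem exists_eq_of_mul_add_mul_eq {a b d i j : ℕ} (ha : 0 < a) (hb : 0 < b)
    (hab : Nat.Coprime a b) (h : a * i + b * j = a * b * d) :
    ∃ l ≤ d, i = b * (d - l) ∧ j = a * l := by
  have hdvd : a ∣ b * j := (Nat.dvd_add_right (Dvd.intro i rfl)).1 (h ▸ ⟨b * d, by ring⟩)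
  obtain ⟨l, rfl⟩ := hab.dvd_of_dvd_mul_left hdvd
  have hl : l ≤ d := by
    refine le_of_mul_le_mul_left (a := a * b) ?_ (Nat.mul_pos ha hb)
    rw [← h]
    nlinarith
  obtain ⟨t, rfl⟩ := Nat.exists_eq_add_of_le hl
  refine ⟨l, hl, ?_, rfl⟩
  rw [Nat.add_sub_cancel_left]
  exact Nat.eq_of_mul_eq_mul_left ha (by linarith)

/-- The monomials of the initial form. -/
theorem initialForm_eq_sum {a b d : ℕ} (ha : 0 < a) (hb : 0 < b) (hd : 0 < d)
    (hab : Nat.Coprime a b) (f : PS K) {S : NEdge} (hA : S.A = (0, a * d)) (hB : S.B = (b * d, 0)) :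
    initialForm K f S = ∑ l ∈ Finset.range (d + 1),
      MvPowerSeries.C (coef K f (b * (d - l), a * l)) * ((Xv K ^ b) ^ (d - l) * (Yv K ^ a) ^ l) := by
  have hmem : ∀ i j, S.mem (i, j) ↔ a * i + b * j = a * b * d := by
    intro i j
    simp only [NEdge.mem, NEdge.len1, NEdge.len2, hA, hB, Nat.sub_zero]
    constructor
    · rintro ⟨-, -, -, hj, h⟩
      obtain ⟨t, ht⟩ := Nat.exists_eq_add_of_le hj
      rw [ht, Nat.add_sub_cancel_left, ← ht] at h
      have h1 : i * a = t * b := Nat.eq_of_mul_eq_mul_right hd (by linarith)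
      calc a * i + b * j = b * (j + t) := by linarith
        _ = a * b * d := by rw [← ht]; ring
    · intro h
      obtain ⟨l, hl, rfl, rfl⟩ := exists_eq_of_mul_add_mul_eq ha hb hab h
      refine ⟨Nat.zero_le _, Nat.mul_le_mul_left _ (Nat.sub_le _ _), Nat.zero_le _,
        Nat.mul_le_mul_left _ hl, ?_⟩
      rw [← Nat.mul_sub]
      ring
  have hterm : ∀ l, MvPowerSeries.C (coef K f (b * (d - l), a * l)) *
      ((Xv K ^ b) ^ (d - l) * (Yv K ^ a) ^ l) =
      MvPowerSeries.monomial (Finsupp.single 0 (b * (d - l)) + Finsupp.single 1 (a * l))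
        (coef K f (b * (d - l), a * l)) := by
    intro l
    rw [Xv, Yv, ← pow_mul, ← pow_mul, MvPowerSeries.X_pow_eq, MvPowerSeries.X_pow_eq,
      MvPowerSeries.monomial_mul_monomial, ← MvPowerSeries.monomial_zero_eq_C_apply,
      MvPowerSeries.monomial_mul_monomial]
    simp
  have hexp : ∀ (e : Fin 2 →₀ ℕ) (i j : ℕ), e = Finsupp.single 0 i + Finsupp.single 1 j ↔
      e 0 = i ∧ e 1 = j := by
    intro e i j
    constructor
    · rintro rfl
      simp
    · rintro ⟨rfl, rfl⟩
      ext t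
      fin_cases t <;> simp
  ext e
  simp only [hterm, map_sum, MvPowerSeries.coeff_monomial, hexp]
  rw [initialForm, coeff_ofCoef]
  simp only [hmem]
  split_ifs with h
  · obtain ⟨l, hl, h0, h1⟩ := exists_eq_of_mul_add_mul_eq ha hb hab h
    rw [Finset.sum_eq_single l, if_pos ⟨h0, h1⟩, h0, h1]
    · intro l' _ hne
      rw [if_neg]
      rintro ⟨-, h2⟩
      exact hne (Nat.eq_of_mul_eq_mul_left ha (h2.symm.trans h1))
    · intro h'
      exact absurd (Finset.mem_range.2 (by omega)) h'
  · refine (Finset.sum_eq_zero fun l hl => if_neg ?_).symm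
    rintro ⟨h0, h1⟩
    apply h
    obtain ⟨t, ht⟩ := Nat.exists_eq_add_of_le (Nat.lt_succ_iff.1 (Finset.mem_range.1 hl))
    rw [h0, h1, ht, Nat.add_sub_cancel_left]
    ring

/-- The form of degree `d` attached to the initial form, at `u = 1`. -/
def edgePolynomial (a b d : ℕ) (f : PS K) : K[X] :=
  ∑ l ∈ Finset.range (d + 1), monomial l (coef K f (b * (d - l), a * l))

theorem coeff_edgePolynomial (a b d : ℕ) (f : PS K) (l : ℕ) :
    (edgePolynomial a b d f).coeff l = if l ≤ d then coef K f (b * (d - l), a * l) else 0 := by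
  simp [edgePolynomial, coeff_monomial]

theorem coeff_weightSeries_eq_expand {a b d : ℕ} (ha : 0 < a) (hb : 0 < b) (hab : Nat.Coprime a b)
    (f : PS K) : PowerSeries.coeff (a * b * d) (weightSeries a b f) =
      expand K a (edgePolynomial a b d f) := by
  ext β
  by_cases hβ : ∃ i, a * i + b * β = a * b * d
  · obtain ⟨i, hi⟩ := hβ
    obtain ⟨l, hl, rfl, rfl⟩ := exists_eq_of_mul_add_mul_eq ha hb hab hi
    rw [← hi, coeff_coeff_weightSeries_add ha hb, coeff_expand_mul' ha, coeff_edgePolynomial,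
      if_pos hl]
  · rw [coeff_coeff_weightSeries hb, if_neg, coeff_expand ha]
    · split_ifs with h
      · obtain ⟨l, rfl⟩ := h
        rw [Nat.mul_div_cancel_left _ ha, coeff_edgePolynomial, if_neg]
        intro hl
        obtain ⟨t, rfl⟩ := Nat.exists_eq_add_of_le hl
        exact hβ ⟨b * t, by ring⟩
      · rfl
    · rintro ⟨h1, i, hi⟩
      exact hβ ⟨i, by omega⟩

/-- The edge polynomial of an irreducible series has a single root. -/
theorem exists_edgePolynomial_eq_of_irreducible [IsAlgClosed K] {a b d : ℕ} (ha : 0 < a)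
    (hb : 0 < b) (hd : 0 < d) (hab : Nat.Coprime a b) {f : PS K}
    (hf : ∀ p ∈ supp K f, a * b * d ≤ a * p.1 + b * p.2) (htop : (0, a * d) ∈ supp K f)
    (hirr : Irreducible f) : ∃ c t : K, edgePolynomial a b d f = C c * (X + C t) ^ d := by
  set P := edgePolynomial a b d f with hP
  have hdeg : P.natDegree = d := by
    refine le_antisymm (natDegree_le_iff_coeff_eq_zero.2 fun l hl => ?_)
      (le_natDegree_of_ne_zero ?_)
    · rw [hP, coeff_edgePolynomial, if_neg (by omega)]
    · rw [hP, coeff_edgePolynomial, if_pos le_rfl, Nat.sub_self, mul_zero]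
      exact htop
  have hP0 : P ≠ 0 := by
    intro h
    rw [h, natDegree_zero] at hdeg
    omega
  obtain ⟨t, ht⟩ := IsAlgClosed.exists_root P (by
    rw [degree_eq_natDegree hP0, hdeg]
    exact_mod_cast hd.ne')
  obtain ⟨h, hfac, hndvd⟩ := exists_eq_pow_rootMultiplicity_mul_and_not_dvd P hP0 t
  have hk : 0 < P.rootMultiplicity t := (rootMultiplicity_pos hP0).2 ht
  set k := P.rootMultiplicity t
  have hmonic : ((X - C t) ^ k).Monic := (monic_X_sub_C t).pow k
  have hgdeg : ((X - C t) ^ k).natDegree = k := by simp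
  have hh0 : h ≠ 0 := fun h0 => hndvd (h0 ▸ dvd_zero _)
  have hsum : k + h.natDegree = d := by
    rw [← hdeg, hfac, hmonic.natDegree_mul' hh0, hgdeg]
  rcases Nat.eq_zero_or_pos h.natDegree with hz | hpos
  · refine ⟨h.coeff 0, -t, ?_⟩
    rw [hfac, eq_C_of_natDegree_eq_zero hz, coeff_C_zero, map_neg, ← sub_eq_add_neg,
      show k = d by omega, mul_comm]
  · refine absurd hirr (not_irreducible_of_isCoprime ha hb hab hmonic ?_ hgdeg hk le_rfl hpos
      (by rwa [hsum]) (by rw [hsum, coeff_weightSeries_eq_expand ha hb hab, ← hP, hfac]))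
    exact IsCoprime.pow_left (((irreducible_X_sub_C t).coprime_iff_not_dvd).2 hndvd)

end Auxiliary

theorem initialForm_elementary (K : Type u) [Field K] [IsAlgClosed K]
    (f : PS K) (hconv : Convenient K f) (S : NEdge) (hS : newtonPolygon K f = {S})
    (m n d : ℕ) (hm : m = ordX K f) (hn : n = ordY K f) (hd : d = Nat.gcd m n) :
    (∃ F : MvPolynomial (Fin 2) K, F.IsHomogeneous d ∧
        initialForm K f S = MvPolynomial.aeval ![Xv K ^ (m / d), Yv K ^ (n / d)] F) ∧
      (Irreducible f → ∃ a b : K,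
        initialForm K f S =
          (MvPowerSeries.C a * Xv K ^ (m / d) +
              MvPowerSeries.C b * Yv K ^ (n / d)) ^ d) := by
  obtain ⟨hA, hB, hmin⟩ := edge_of_newtonPolygon_eq_singleton hconv hS
  rw [← hn] at hA
  rw [← hm] at hB
  rw [← hm, ← hn] at hmin
  have hm0 : 0 < m := by
    have := S.hx
    rw [hA, hB] at this
    exact this
  have hn0 : 0 < n := by
    have := S.hy
    rw [hA, hB] at this
    exact this
  have hd0 : 0 < d := hd ▸ Nat.gcd_pos_of_pos_left _ hm0
  have hcop : Nat.Coprime (n / d) (m / d) := by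
    rw [hd]
    exact (Nat.coprime_div_gcd_div_gcd (hd ▸ hd0)).symm
  have hmd : m / d * d = m := Nat.div_mul_cancel (hd ▸ Nat.gcd_dvd_left m n)
  have hnd : n / d * d = n := Nat.div_mul_cancel (hd ▸ Nat.gcd_dvd_right m n)
  generalize m / d = b at *
  generalize n / d = a at *
  subst hmd hnd
  have ha : 0 < a := Nat.pos_of_mul_pos_right hn0
  have hb : 0 < b := Nat.pos_of_mul_pos_right hm0
  have hform := initialForm_eq_sum ha hb hd0 hcop f hA hB
  refine ⟨⟨∑ l ∈ Finset.range (d + 1), MvPolynomial.C (coef K f (b * (d - l), a * l)) *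
    (MvPolynomial.X 0 ^ (d - l) * MvPolynomial.X 1 ^ l), ?_, ?_⟩, fun hirr => ?_⟩
  · refine MvPolynomial.IsHomogeneous.sum _ _ _ fun l hl => ?_
    have h1 := ((MvPolynomial.isHomogeneous_X_pow (R := K) (0 : Fin 2) (d - l)).mul
      (MvPolynomial.isHomogeneous_X_pow (R := K) (1 : Fin 2) l)).C_mul
        (coef K f (b * (d - l), a * l))
    rwa [Nat.sub_add_cancel (Nat.lt_succ_iff.1 (Finset.mem_range.1 hl))] at h1
  · rw [hform, map_sum]
    refine Finset.sum_congr rfl fun l _ => ?_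
    simp only [map_mul, map_pow, MvPolynomial.aeval_X, MvPolynomial.aeval_C]
    rfl
  · have htop : (0, a * d) ∈ supp K f := by
      rw [hn]
      exact Nat.sInf_mem hconv.2
    obtain ⟨c, t, hct⟩ := exists_edgePolynomial_eq_of_irreducible ha hb hd0 hcop
      (fun p hp => le_of_mul_le_mul_left (a := d) (by linarith [hmin p hp]) hd0) htop hirr
    obtain ⟨z, rfl⟩ := IsAlgClosed.exists_pow_nat_eq c hd0
    refine ⟨z * t, z, ?_⟩
    rw [hform, add_comm (MvPowerSeries.C (z * t) * _), add_pow]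
    refine Finset.sum_congr rfl fun l hl => ?_
    have hl' : l ≤ d := Nat.lt_succ_iff.1 (Finset.mem_range.1 hl)
    have hcoeff := congrArg (fun P => Polynomial.coeff P l) hct
    simp only [coeff_edgePolynomial, if_pos hl', Polynomial.coeff_C_mul,
      Polynomial.coeff_X_add_C_pow] at hcoeff
    have hz : z ^ d = z ^ l * z ^ (d - l) := by rw [← pow_add, Nat.add_sub_cancel' hl']
    rw [hcoeff, hz]
    simp only [map_mul, map_pow, map_natCast, mul_pow]
    ring

end PlaneCurveNote
end
end

section
/- (Newton factorization) Let K be an algebraically closed field and let f ∈ K[[x,y]] be convenient. Then f = ∏_{S ∈ N_f} f_S in K[[x,y]], where each f_S is an elementary power series of bidegree (|S|₁, |S|₂), and In f_S = c · ī(f,S) for some nonzero constant c ∈ K. -/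
/-!
Common definitions for formalizing "A note on the plane curve singularities in
positive characteristic" by E. García Barroso and A. Płoski.

We work with the ring `K[[x,y]] := MvPowerSeries (Fin 2) K`, where `x` is the
variable of index `0` and `y` the variable of index `1`.
-/

open scoped Classical

noncomputable section

universe u

namespace PlaneCurveNote

variable (K : Type u) [Field K]

/-- The exponent of `x^i y^j`. -/
def expo (p : ℕ × ℕ) : Fin 2 →₀ ℕ := Finsupp.single 0 p.1 + Finsupp.single 1 p.2

/-- The monomial `c x^i y^j`. -/
def mon (q : ℕ × ℕ) (c : K) : PS K := MvPowerSeries.monomial (expo q) c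

/-- The value of the linear form `w` at the lattice point `p`. -/
def wt (w p : ℕ × ℕ) : ℕ := w.1 * p.1 + w.2 * p.2

lemma wt_add (w p q : ℕ × ℕ) : wt w (p + q) = wt w p + wt w q := by
  simp only [wt, Prod.fst_add, Prod.snd_add]; ring

lemma expo_surj (m : Fin 2 →₀ ℕ) : expo (m 0, m 1) = m := by
  ext i; fin_cases i <;> simp [expo]

lemma expo_apply_zero (p : ℕ × ℕ) : expo p 0 = p.1 := by simp [expo]

lemma expo_apply_one (p : ℕ × ℕ) : expo p 1 = p.2 := by simp [expo]

lemma expo_injective : Function.Injective expo := fun p q h =>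
  Prod.ext (by rw [← expo_apply_zero, h, expo_apply_zero])
    (by rw [← expo_apply_one, h, expo_apply_one])

lemma expo_add (p q : ℕ × ℕ) : expo (p + q) = expo p + expo q := by
  ext i; fin_cases i <;> simp [expo]

variable {K}

lemma coef_eq (f : PS K) (p : ℕ × ℕ) : coef K f p = MvPowerSeries.coeff (expo p) f := rfl

lemma coef_ext {f g : PS K} (h : ∀ p, coef K f p = coef K g p) : f = g := by
  ext m
  simpa only [coef_eq, expo_surj] using h (m 0, m 1)

lemma coef_ofCoef (c : ℕ × ℕ → K) (p : ℕ × ℕ) : coef K (ofCoef K c) p = c p := by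
  change c (expo p 0, expo p 1) = c p
  rw [expo_apply_zero, expo_apply_one]

lemma coef_add (f g : PS K) (p : ℕ × ℕ) : coef K (f + g) p = coef K f p + coef K g p := by
  simp [coef_eq]

lemma coef_sub (f g : PS K) (p : ℕ × ℕ) : coef K (f - g) p = coef K f p - coef K g p := by
  simp [coef_eq]

lemma coef_C_mul (c : K) (f : PS K) (p : ℕ × ℕ) :
    coef K (MvPowerSeries.C (σ := Fin 2) (R := K) c * f) p = c * coef K f p := by
  simp [coef_eq]

lemma coef_mon (q p : ℕ × ℕ) (c : K) : coef K (mon K q c) p = if p = q then c else 0 := by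
  simp only [coef_eq, mon, MvPowerSeries.coeff_monomial, expo_injective.eq_iff]

lemma coef_mon_mul_add (q p : ℕ × ℕ) (c : K) (f : PS K) :
    coef K (mon K q c * f) (q + p) = c * coef K f p := by
  rw [coef_eq, mon, expo_add, MvPowerSeries.coeff_add_monomial_mul, coef_eq]

lemma coef_mon_mul_of_not_le {q p : ℕ × ℕ} (h : ¬ q ≤ p) (c : K) (f : PS K) :
    coef K (mon K q c * f) p = 0 := by
  rw [coef_eq, mon, MvPowerSeries.coeff_monomial_mul, if_neg]
  intro hle
  refine h ⟨?_, ?_⟩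
  · simpa only [expo_apply_zero] using hle 0
  · simpa only [expo_apply_one] using hle 1

lemma constantCoeff_eq_coef (f : PS K) : MvPowerSeries.constantCoeff f = coef K f (0, 0) := by
  simp [coef_eq, expo]

/-- A nonzero coefficient of a product comes from nonzero coefficients of the factors. -/
lemma exists_of_coef_mul_ne_zero {f g : PS K} {p : ℕ × ℕ} (h : coef K (f * g) p ≠ 0) :
    ∃ q r, q + r = p ∧ coef K f q ≠ 0 ∧ coef K g r ≠ 0 := by
  rw [coef_eq, MvPowerSeries.coeff_mul] at h
  obtain ⟨⟨m, l⟩, hm, hne⟩ := Finset.exists_ne_zero_of_sum_ne_zero h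
  refine ⟨(m 0, m 1), (l 0, l 1), ?_, ?_, ?_⟩
  · apply expo_injective
    rw [expo_add, expo_surj, expo_surj]
    simpa using hm
  · rw [coef_eq, expo_surj]; exact left_ne_zero_of_mul hne
  · rw [coef_eq, expo_surj]; exact right_ne_zero_of_mul hne

variable (K) in
/-- The ideal of series of `w`-weighted order at least `d`. -/
def ordIdeal (w : ℕ × ℕ) (d : ℕ) : Ideal (PS K) where
  carrier := {f | ∀ p, coef K f p ≠ 0 → d ≤ wt w p}
  add_mem' {f g} hf hg p hp := by
    by_cases h : coef K f p = 0
    · refine hg p fun h' => hp ?_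
      rw [coef_add, h, h', add_zero]
    · exact hf p h
  zero_mem' p hp := absurd (by simp [coef_eq]) hp
  smul_mem' f g hg p hp := by
    obtain ⟨q, r, rfl, -, hr⟩ := exists_of_coef_mul_ne_zero hp
    have := hg r hr
    rw [wt_add]; omega

lemma coef_eq_zero_of_mem {w : ℕ × ℕ} {d : ℕ} {f : PS K} (hf : f ∈ ordIdeal K w d)
    {p : ℕ × ℕ} (hp : wt w p < d) : coef K f p = 0 := by
  by_contra h
  exact absurd (hf p h) (by omega)

lemma coef_congr_of_sub_mem {w : ℕ × ℕ} {d : ℕ} {f g : PS K} (h : f - g ∈ ordIdeal K w d)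
    {p : ℕ × ℕ} (hp : wt w p < d) : coef K f p = coef K g p := by
  have := coef_eq_zero_of_mem h hp
  rwa [coef_sub, sub_eq_zero] at this

lemma ordIdeal_anti {w : ℕ × ℕ} {d e : ℕ} (h : d ≤ e) : ordIdeal K w e ≤ ordIdeal K w d :=
  fun _ hf p hp => h.trans (hf p hp)

lemma mul_mem_ordIdeal {w : ℕ × ℕ} {d e : ℕ} {f g : PS K} (hf : f ∈ ordIdeal K w d)
    (hg : g ∈ ordIdeal K w e) : f * g ∈ ordIdeal K w (d + e) := by
  intro p hp
  obtain ⟨q, r, rfl, hq, hr⟩ := exists_of_coef_mul_ne_zero hp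
  rw [wt_add]
  exact add_le_add (hf q hq) (hg r hr)

lemma mon_mem_ordIdeal (w q : ℕ × ℕ) (c : K) : mon K q c ∈ ordIdeal K w (wt w q) := by
  intro p hp
  rw [coef_mon] at hp
  rw [(ite_ne_right_iff.1 hp).1]

lemma eq_zero_of_forall_mem_ordIdeal {w : ℕ × ℕ} {f : PS K} (h : ∀ d, f ∈ ordIdeal K w d) :
    f = 0 :=
  coef_ext fun p => by
    rw [coef_eq_zero_of_mem (h (wt w p + 1)) (Nat.lt_succ_self _)]
    simp [coef_eq]

/-- Division by `G` and `y^b`, in weighted degrees at least that of `x^a y^b`, where `G` has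
weighted order at least that of `x^a` and `G(x,0) = c x^a`. -/
lemma exists_division {w : ℕ × ℕ} (hw : 0 < w.1) {a b : ℕ} {c : K} (hc : c ≠ 0) {G : PS K}
    (hG : G ∈ ordIdeal K w (wt w (a, 0))) (hG' : G - mon K (a, 0) c ∈ ordIdeal K (0, 1) 1)
    (k m : ℕ) (hm : m ≤ b) {r : PS K} (hr : r ∈ ordIdeal K w (wt w (a, b) + k))
    (hr' : r ∈ ordIdeal K (0, 1) (b - m)) :
    ∃ u ∈ ordIdeal K w (wt w (a, 0) + k), ∃ v ∈ ordIdeal K w (wt w (0, b) + k),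
      r = G * v + mon K (0, b) 1 * u := by
  induction m generalizing r with
  | zero =>
    refine ⟨ofCoef K fun p => coef K r (p.1, p.2 + b), ?_, 0, zero_mem _, ?_⟩
    · intro p hp
      rw [coef_ofCoef] at hp
      have := hr _ hp
      simp only [wt] at this ⊢
      nlinarith
    · refine coef_ext fun p => ?_
      rw [mul_zero, zero_add]
      by_cases h : (0, b) ≤ p
      · obtain ⟨q, rfl⟩ := exists_add_of_le h
        rw [coef_mon_mul_add, coef_ofCoef, one_mul, Prod.add_def, zero_add, add_comm b]
      · rw [coef_mon_mul_of_not_le h]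
        apply coef_eq_zero_of_mem hr'
        simpa [wt, Prod.le_def] using h
  | succ m ih =>
    set t := b - (m + 1) with ht
    let v₁ : PS K := ofCoef K fun p => if p.2 = t then c⁻¹ * coef K r (p.1 + a, p.2) else 0
    have hv₁ : ∀ p, coef K v₁ p ≠ 0 → p.2 = t ∧ coef K r (p.1 + a, p.2) ≠ 0 := by
      intro p hp
      simp only [v₁, coef_ofCoef] at hp
      obtain ⟨h1, h2⟩ := ite_ne_right_iff.1 hp
      exact ⟨h1, right_ne_zero_of_mul h2⟩
    have hv₁w : v₁ ∈ ordIdeal K w (wt w (0, b) + k) := by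
      intro p hp
      have := hr _ (hv₁ p hp).2
      simp only [wt] at this ⊢
      nlinarith
    have hv₁t : v₁ ∈ ordIdeal K (0, 1) t := by
      intro p hp
      simp [wt, (hv₁ p hp).1]
    have hGv : G * v₁ ∈ ordIdeal K w (wt w (a, b) + k) := by
      have := mul_mem_ordIdeal hG hv₁w
      refine ordIdeal_anti (le_of_eq ?_) this
      simp only [wt]; ring
    have hrow : r - mon K (a, 0) c * v₁ ∈ ordIdeal K (0, 1) (t + 1) := by
      intro p hp
      by_contra hlt
      have hpt : p.2 ≤ t := by simpa [wt] using hlt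
      apply hp
      rw [coef_sub, sub_eq_zero]
      by_cases h : (a, 0) ≤ p
      · obtain ⟨q, rfl⟩ := exists_add_of_le h
        rw [coef_mon_mul_add]
        simp only [v₁, coef_ofCoef]
        simp only [Prod.snd_add, zero_add] at hpt
        split_ifs with hq
        · rw [mul_inv_cancel_left₀ hc, Prod.add_def, zero_add, add_comm a]
        · rw [mul_zero]
          apply coef_eq_zero_of_mem hr'
          simp only [wt, Prod.snd_add]; omega
      · rw [coef_mon_mul_of_not_le h]
        have hpa : p.1 < a := by simpa [Prod.le_def] using h
        apply coef_eq_zero_of_mem hr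
        simp only [wt]
        have : w.2 * p.2 ≤ w.2 * b := Nat.mul_le_mul_left _ (by omega)
        nlinarith
    obtain ⟨u, hu, v, hv, huv⟩ := ih (r := r - G * v₁) (by omega) (sub_mem hr hGv) (by
      have h1 := mul_mem_ordIdeal hG' hv₁t
      rw [add_comm] at h1
      have := sub_mem hrow h1
      rw [show b - m = t + 1 by omega]
      convert this using 1
      ring)
    refine ⟨u, hu, v + v₁, add_mem hv hv₁w, ?_⟩
    rw [mul_add, add_right_comm, ← huv]; ring

/-- A sequence which is Cauchy for the weighted order has a limit. -/
lemma exists_limit {w : ℕ × ℕ} {s : ℕ → PS K} (hs : ∀ k, s (k + 1) - s k ∈ ordIdeal K w (k + 1)) :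
    ∃ g, ∀ k, g - s k ∈ ordIdeal K w (k + 1) := by
  have hadd : ∀ k l, s (k + l) - s k ∈ ordIdeal K w (k + 1) := by
    intro k l
    induction l with
    | zero => simp
    | succ l ih =>
      have := add_mem (ordIdeal_anti (by omega) (hs (k + l))) ih
      rwa [sub_add_sub_cancel] at this
  refine ⟨ofCoef K fun p => coef K (s (wt w p)) p, fun k p hp => ?_⟩
  by_contra hlt
  obtain ⟨l, hl⟩ := Nat.exists_eq_add_of_le (show wt w p ≤ k by omega)
  apply hp
  rw [coef_sub, coef_ofCoef, sub_eq_zero, hl]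
  exact (coef_congr_of_sub_mem (hadd _ l) (Nat.lt_succ_self _)).symm

/-- Lifting of the factorization `G · y^b` of the initial part of `f`. -/
lemma exists_factorization {w : ℕ × ℕ} (hw : 0 < w.1) {a b : ℕ} {c : K} (hc : c ≠ 0)
    {f G : PS K} (hG : G ∈ ordIdeal K w (wt w (a, 0)))
    (hG' : G - mon K (a, 0) c ∈ ordIdeal K (0, 1) 1)
    (hf : f - G * mon K (0, b) 1 ∈ ordIdeal K w (wt w (a, b) + 1)) :
    ∃ g h, f = g * h ∧ g - G ∈ ordIdeal K w (wt w (a, 0) + 1) ∧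
      h - mon K (0, b) 1 ∈ ordIdeal K w (wt w (0, b) + 1) := by
  have hab : wt w (a, b) = wt w (a, 0) + wt w (0, b) := by simp [wt]
  let P : ℕ → PS K × PS K → Prop := fun k s =>
    s.1 - G ∈ ordIdeal K w (wt w (a, 0) + 1) ∧
    s.2 - mon K (0, b) 1 ∈ ordIdeal K w (wt w (0, b) + 1) ∧
    f - s.1 * s.2 ∈ ordIdeal K w (wt w (a, b) + (k + 1))
  have step : ∀ k (s : {s // P k s}), ∃ s' : {s // P (k + 1) s},
      s'.1.1 - s.1.1 ∈ ordIdeal K w (k + 1) ∧ s'.1.2 - s.1.2 ∈ ordIdeal K w (k + 1) := by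
    rintro k ⟨⟨g, h⟩, hg, hh, hgh⟩
    dsimp only at hg hh hgh
    obtain ⟨u, hu, v, hv, huv⟩ := exists_division hw hc hG hG' (k + 1) b le_rfl hgh
      (fun p _ => by simp)
    refine ⟨⟨⟨g + u, h + v⟩, ?_, ?_, ?_⟩, ?_, ?_⟩
    · dsimp only
      rw [add_sub_right_comm]
      exact add_mem hg (ordIdeal_anti (by omega) hu)
    · dsimp only
      rw [add_sub_right_comm]
      exact add_mem hh (ordIdeal_anti (by omega) hv)
    · dsimp only
      have e : f - (g + u) * (h + v) =
          -(u * (h - mon K (0, b) 1) + (g - G) * v + u * v) := by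
        linear_combination huv
      rw [e]
      refine neg_mem (add_mem (add_mem ?_ ?_) ?_)
      · exact ordIdeal_anti (by omega) (mul_mem_ordIdeal hu hh)
      · exact ordIdeal_anti (by omega) (mul_mem_ordIdeal hg hv)
      · exact ordIdeal_anti (by omega) (mul_mem_ordIdeal hu hv)
    · simpa using ordIdeal_anti (by omega) hu
    · simpa using ordIdeal_anti (by omega) hv
  choose next hnext using step
  let s : ∀ k, {s // P k s} := fun k =>
    Nat.rec ⟨(G, mon K (0, b) 1), by simp, by simp, by simpa using hf⟩ next k
  obtain ⟨g, hg⟩ := exists_limit (s := fun k => (s k).1.1) fun k => (hnext k (s k)).1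
  obtain ⟨h, hh⟩ := exists_limit (s := fun k => (s k).1.2) fun k => (hnext k (s k)).2
  refine ⟨g, h, ?_, ?_, ?_⟩
  · rw [← sub_eq_zero]
    refine eq_zero_of_forall_mem_ordIdeal (w := w) fun d => ?_
    have e : f - g * h = (f - (s d).1.1 * (s d).1.2) - (g - (s d).1.1) * h
        - (s d).1.1 * (h - (s d).1.2) := by ring
    rw [e]
    refine sub_mem (sub_mem ?_ ?_) ?_
    · exact ordIdeal_anti (by omega) (s d).2.2.2
    · exact Ideal.mul_mem_right _ _ (ordIdeal_anti (by omega) (hg d))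
    · exact Ideal.mul_mem_left _ _ (ordIdeal_anti (by omega) (hh d))
  · have := add_mem (ordIdeal_anti (by omega) (hg (wt w (a, 0)))) (s (wt w (a, 0))).2.1
    rwa [sub_add_sub_cancel] at this
  · have := add_mem (ordIdeal_anti (by omega) (hh (wt w (0, b)))) (s (wt w (0, b))).2.2.1
    rwa [sub_add_sub_cancel] at this

/-- If the `w`-initial part of `g` is the monomial `c x^i y^j`, then multiplication by `g`
shifts initial coefficients. -/
lemma coef_mul_add_of_monomial {w q : ℕ × ℕ} {c : K} {g h : PS K} {d : ℕ}
    (hg : g - mon K q c ∈ ordIdeal K w (wt w q + 1)) (hh : h ∈ ordIdeal K w d)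
    {p : ℕ × ℕ} (hp : wt w p = d) : coef K (g * h) (q + p) = c * coef K h p := by
  rw [← coef_mon_mul_add]
  refine coef_congr_of_sub_mem (w := w) (d := wt w q + 1 + d) ?_ (by rw [wt_add]; omega)
  rw [← sub_mul]
  exact mul_mem_ordIdeal hg hh

lemma coef_mul_eq_zero_of_monomial {w q : ℕ × ℕ} {c : K} {g h : PS K} {d : ℕ}
    (hg : g - mon K q c ∈ ordIdeal K w (wt w q + 1)) (hh : h ∈ ordIdeal K w d)
    {p : ℕ × ℕ} (hp : wt w p = wt w q + d) (hqp : ¬ q ≤ p) : coef K (g * h) p = 0 := by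
  rw [← coef_mon_mul_of_not_le hqp c h]
  refine coef_congr_of_sub_mem (w := w) (d := wt w q + 1 + d) ?_ (by omega)
  rw [← sub_mul]
  exact mul_mem_ordIdeal hg hh

lemma mem_ordIdeal_of_sub_mon_mem {w q : ℕ × ℕ} {c : K} {g : PS K}
    (hg : g - mon K q c ∈ ordIdeal K w (wt w q + 1)) : g ∈ ordIdeal K w (wt w q) := by
  have := add_mem (ordIdeal_anti (Nat.le_succ _) hg) (mon_mem_ordIdeal w q c)
  rwa [sub_add_cancel] at this

lemma exists_min {f : PS K} (w : ℕ × ℕ) {p : ℕ × ℕ} (hp : p ∈ supp K f) :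
    ∃ q ∈ supp K f, f ∈ ordIdeal K w (wt w q) := by
  obtain ⟨q, hq, hmin⟩ := WellFounded.has_min (InvImage.wf (wt w) Nat.lt_wfRel.wf) (supp K f) ⟨p, hp⟩
  exact ⟨q, hq, fun r hr => not_lt.1 (hmin r hr)⟩

/-- `S` is the compact edge of the Newton diagram of `f` on which `w` is minimal. -/
def IsEdge (w : ℕ × ℕ) (f : PS K) (S : NEdge) : Prop :=
  S.A ∈ supp K f ∧ S.B ∈ supp K f ∧ wt w S.B = wt w S.A ∧ f ∈ ordIdeal K w (wt w S.A) ∧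
    ∀ p ∈ supp K f, wt w p = wt w S.A → S.A.1 ≤ p.1 ∧ p.1 ≤ S.B.1

lemma mem_newtonPolygon {f : PS K} {S : NEdge} :
    S ∈ newtonPolygon K f ↔ ∃ w : ℕ × ℕ, 0 < w.1 ∧ 0 < w.2 ∧ IsEdge w f S := by
  constructor
  · rintro ⟨hA, hB, w, h1, h2, h⟩
    exact ⟨w, h1, h2, hA, hB, h⟩
  · rintro ⟨w, h1, h2, hA, hB, h⟩
    exact ⟨hA, hB, w, h1, h2, h⟩

/-- Translation of an edge by `(a, 0)`. -/
def shift (a : ℕ) (S : NEdge) : NEdge where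
  A := (a, 0) + S.A
  B := (a, 0) + S.B
  hx := by simpa using S.hx
  hy := by simpa using S.hy

lemma NEdge.eq_of {S T : NEdge} (hA : S.A = T.A) (hB : S.B = T.B) : S = T := by
  cases S; cases T; simp_all

lemma shift_injective (a : ℕ) : Function.Injective (shift a) := fun _ _ h =>
  NEdge.eq_of (add_left_cancel (congrArg NEdge.A h)) (add_left_cancel (congrArg NEdge.B h))

lemma shift_len1 (a : ℕ) (S : NEdge) : (shift a S).len1 = S.len1 := by
  simp [shift, NEdge.len1, Nat.add_sub_add_left]

lemma shift_len2 (a : ℕ) (S : NEdge) : (shift a S).len2 = S.len2 := by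
  simp [shift, NEdge.len2]

lemma shift_mem (a : ℕ) (S : NEdge) (p : ℕ × ℕ) : (shift a S).mem ((a, 0) + p) ↔ S.mem p := by
  simp only [NEdge.mem, shift_len1, shift_len2]
  simp [shift, Nat.add_sub_add_left]

/-- The points of an edge have the same weight. -/
lemma wt_of_mem {w : ℕ × ℕ} {S : NEdge} (h : wt w S.B = wt w S.A) {p : ℕ × ℕ} (hp : S.mem p) :
    wt w p = wt w S.A := by
  obtain ⟨⟨a, n⟩, ⟨a', b⟩, hx, hy⟩ := S
  obtain ⟨i, j⟩ := p
  simp only [NEdge.mem, wt, NEdge.len1, NEdge.len2] at *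
  dsimp only at hx hy
  obtain ⟨h1, -, -, h4, h5⟩ := hp
  obtain ⟨l, rfl⟩ := Nat.exists_eq_add_of_lt hx
  obtain ⟨e, rfl⟩ := Nat.exists_eq_add_of_lt hy
  obtain ⟨s, rfl⟩ := Nat.exists_eq_add_of_le h1
  obtain ⟨t, ht⟩ := Nat.exists_eq_add_of_le h4
  rw [show a + l + 1 - a = l + 1 by omega, show b + e + 1 - b = e + 1 by omega,
    show a + s - a = s by omega, show b + e + 1 - j = t by omega] at h5
  have h6 : w.1 * (l + 1) = w.2 * (e + 1) := by nlinarith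
  have h7 : w.1 * s = w.2 * t := by
    apply Nat.eq_of_mul_eq_mul_left (Nat.succ_pos e)
    calc (e + 1) * (w.1 * s) = w.1 * (s * (e + 1)) := by ring
      _ = t * (w.1 * (l + 1)) := by rw [h5]; ring
      _ = (e + 1) * (w.2 * t) := by rw [h6]; ring
  rw [ht]
  nlinarith

/-- A series whose `w`-initial part contains a power of `x` and a power of `y` is elementary. -/
lemma elementary_of_mem_ordIdeal {w : ℕ × ℕ} (hw₁ : 0 < w.1) (hw₂ : 0 < w.2) {f : PS K}
    {T : NEdge} (hA₁ : T.A.1 = 0) (hB₂ : T.B.2 = 0) (hA : T.A ∈ supp K f) (hB : T.B ∈ supp K f)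
    (hw : wt w T.B = wt w T.A) (hf : f ∈ ordIdeal K w (wt w T.A)) :
    Convenient K f ∧ ordX K f = T.B.1 ∧ ordY K f = T.A.2 ∧ newtonPolygon K f = {T} := by
  obtain ⟨⟨z, n⟩, ⟨a, z'⟩, ha, hn⟩ := T
  simp only at hA₁ hB₂
  subst hA₁ hB₂
  simp only [wt, mul_zero, add_zero, zero_add] at *
  have hconvex : ∀ p ∈ supp K f, a * n ≤ n * p.1 + a * p.2 := by
    intro p hp
    have h := hf p hp
    simp only [wt] at h
    apply Nat.le_of_mul_le_mul_left _ hw₁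
    calc w.1 * (a * n) = n * (w.2 * n) := by rw [← hw]; ring
      _ ≤ n * (w.1 * p.1 + w.2 * p.2) := Nat.mul_le_mul_left _ h
      _ = w.1 * n * p.1 + (w.2 * n) * p.2 := by ring
      _ = w.1 * (n * p.1 + a * p.2) := by rw [← hw]; ring
  refine ⟨⟨⟨a, hB⟩, ⟨n, hA⟩⟩, ?_, ?_, ?_⟩
  · refine le_antisymm (Nat.sInf_le hB) (le_csInf ⟨a, hB⟩ fun i hi => ?_)
    have := hconvex _ hi
    simp only at this
    nlinarith
  · refine le_antisymm (Nat.sInf_le hA) (le_csInf ⟨n, hA⟩ fun i hi => ?_)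
    have := hconvex _ hi
    simp only at this
    nlinarith
  · refine Set.eq_singleton_iff_unique_mem.2 ⟨?_, ?_⟩
    · refine mem_newtonPolygon.2 ⟨w, hw₁, hw₂, hA, hB, by simpa [wt] using hw,
        by simpa [wt] using hf, fun p hp hpw => ⟨Nat.zero_le _, ?_⟩⟩
      simp only [wt, mul_zero, zero_add] at hpw
      refine Nat.le_of_mul_le_mul_left ?_ hw₁
      dsimp only
      omega
    · intro T' hT'
      obtain ⟨v, hv₁, hv₂, hA', hB', hv, hfv, hface⟩ := mem_newtonPolygon.1 hT'
      obtain ⟨⟨α, β⟩, ⟨α', β'⟩, hx, hy⟩ := T'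
      have ha' := hfv _ hB
      have hn' := hfv _ hA
      have hcA := hconvex _ hA'
      have hcB := hconvex _ hB'
      simp only [wt, mul_zero, add_zero, zero_add] at *
      rcases lt_trichotomy (v.1 * a) (v.2 * n) with hlt | heq | hgt
      · exfalso
        have hβ : 0 < β := by omega
        have h1 : v.1 * (a * n) ≤ v.1 * (n * α + a * β) := Nat.mul_le_mul_left _ hcA
        have h2 : v.1 * a * β < v.2 * n * β := Nat.mul_lt_mul_of_pos_right hlt hβ
        have h3 : n * (v.1 * α + v.2 * β) ≤ n * (v.1 * a) := Nat.mul_le_mul_left _ ha'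
        nlinarith
      · have h0 := hface (0, n) hA
        have h1 := hface (a, 0) hB
        have hmin : v.1 * a ≤ v.1 * α + v.2 * β := by
          apply Nat.le_of_mul_le_mul_left _ hn
          calc n * (v.1 * a) = v.1 * (a * n) := by ring
            _ ≤ v.1 * (n * α + a * β) := Nat.mul_le_mul_left _ hcA
            _ = n * (v.1 * α) + (v.1 * a) * β := by ring
            _ = n * (v.1 * α + v.2 * β) := by rw [heq]; ring
        simp only [mul_zero, add_zero, zero_add] at h0 h1
        have h0' := h0 (by omega)
        have h1' := h1 (by omega)
        have hα : α = 0 := by omega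
        subst hα
        have hβ : β = n := by
          apply Nat.eq_of_mul_eq_mul_left hv₂
          omega
        have h2 : v.1 * a ≤ v.1 * α' := Nat.mul_le_mul_left _ h1'.2
        have hα' : α' = a := by
          apply Nat.eq_of_mul_eq_mul_left hv₁
          omega
        have hβ' : β' = 0 := by
          have : v.2 * β' = 0 := by omega
          simpa [hv₂.ne'] using this
        subst hβ hα' hβ'
        rfl
      · exfalso
        have hα' : 0 < α' := by omega
        have h1 : v.2 * (a * n) ≤ v.2 * (n * α' + a * β') := Nat.mul_le_mul_left _ hcB
        have h2 : v.2 * n * α' < v.1 * a * α' := Nat.mul_lt_mul_of_pos_right hgt hα'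
        have h3 : a * (v.1 * α' + v.2 * β') ≤ a * (v.2 * n) := Nat.mul_le_mul_left _ (by omega)
        nlinarith

/-- The edge of the Newton polygon which starts on the vertical axis. -/
lemma exists_first_edge {f : PS K} (hconv : Convenient K f) (h0 : coef K f (0, 0) = 0) :
    ∃ S ∈ newtonPolygon K f, S.A.1 = 0 := by
  obtain ⟨⟨m, hm⟩, hy⟩ := hconv
  obtain ⟨n, hn, hmin⟩ : ∃ n, (0, n) ∈ supp K f ∧ ∀ b, (0, b) ∈ supp K f → n ≤ b :=
    ⟨Nat.find hy, Nat.find_spec hy, fun b hb => Nat.find_min' hy hb⟩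
  have hn0 : 0 < n := Nat.pos_of_ne_zero fun h => hn (by rw [h, h0])
  let slope : ℕ × ℕ → ℕ := fun p => p.1 * (n.factorial / (n - p.2))
  have hslope : ∀ p : ℕ × ℕ, p.2 < n → slope p * (n - p.2) = p.1 * n.factorial := by
    intro p hp
    rw [mul_assoc, Nat.div_mul_cancel]
    exact Nat.dvd_factorial (by omega) (by omega)
  obtain ⟨⟨a, b⟩, ⟨hab, hbn⟩, hab'⟩ := WellFounded.has_min
    (InvImage.wf (fun p : ℕ × ℕ => toLex (slope p, p.2)) wellFounded_lt)
    {p | p ∈ supp K f ∧ p.2 < n} ⟨(m, 0), hm, hn0⟩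
  dsimp only at hbn
  have ha : 0 < a := by
    refine Nat.pos_of_ne_zero fun h => ?_
    subst h
    have := hmin b hab
    omega
  have hlex : ∀ p ∈ supp K f, p.2 < n →
      slope (a, b) < slope p ∨ slope (a, b) = slope p ∧ b ≤ p.2 := by
    intro p hp hpn
    have := hab' p ⟨hp, hpn⟩
    rw [InvImage, not_lt, Prod.Lex.toLex_le_toLex] at this
    exact this
  have key : ∀ p ∈ supp K f, p.2 < n → a * (n - p.2) < p.1 * (n - b) ∨
      a * (n - p.2) = p.1 * (n - b) ∧ b ≤ p.2 := by
    intro p hp hpn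
    have h1 := hslope (a, b) hbn
    have h2 := hslope p hpn
    dsimp only at h1
    have hpos : 0 < (n - p.2) * (n - b) := Nat.mul_pos (by omega) (by omega)
    have e1 : n.factorial * (a * (n - p.2)) = slope (a, b) * ((n - p.2) * (n - b)) := by
      calc _ = (a * n.factorial) * (n - p.2) := by ring
        _ = _ := by rw [← h1]; ring
    have e2 : n.factorial * (p.1 * (n - b)) = slope p * ((n - p.2) * (n - b)) := by
      calc _ = (p.1 * n.factorial) * (n - b) := by ring
        _ = _ := by rw [← h2]; ring
    rcases hlex p hp hpn with h | ⟨h, hb⟩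
    · left
      apply Nat.lt_of_mul_lt_mul_left (a := n.factorial)
      rw [e1, e2]
      exact Nat.mul_lt_mul_of_pos_right h hpos
    · right
      refine ⟨Nat.eq_of_mul_eq_mul_left n.factorial_pos ?_, hb⟩
      rw [e1, e2, h]
  refine ⟨⟨(0, n), (a, b), ha, hbn⟩, mem_newtonPolygon.2 ⟨(n - b, a), ?_, ha, hn, hab, ?_, ?_, ?_⟩,
    rfl⟩
  · dsimp only; omega
  · simp only [wt]
    rw [mul_comm, ← mul_add, mul_zero, zero_add]
    congr 1; omega
  · intro p hp
    simp only [wt, mul_zero, zero_add]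
    rcases lt_or_ge p.2 n with h | h
    · have e : a * n = a * (n - p.2) + a * p.2 := by rw [← mul_add]; congr 1; omega
      rw [e, mul_comm (n - b)]
      rcases key p hp h with h' | ⟨h', -⟩ <;> omega
    · exact (Nat.mul_le_mul_left a h).trans (Nat.le_add_left _ _)
  · intro p hp hpw
    simp only [wt, mul_zero, zero_add] at hpw ⊢
    refine ⟨Nat.zero_le _, ?_⟩
    rcases lt_or_ge p.2 n with h | h
    · have e : a * n = a * (n - p.2) + a * p.2 := by rw [← mul_add]; congr 1; omega
      rw [mul_comm (n - b)] at hpw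
      rcases key p hp h with h' | ⟨h', hb⟩
      · omega
      · refine Nat.le_of_mul_le_mul_right (c := n - b) ?_ (by omega)
        rw [← h']
        exact Nat.mul_le_mul_left _ (by omega)
    · have h1 := Nat.mul_le_mul_left a h
      have h2 : (n - b) * p.1 = 0 := by omega
      have : p.1 = 0 := by
        rcases Nat.mul_eq_zero.1 h2 with h | h <;> omega
      omega

/-- The initial part of `g` with respect to a weight `v` which is flatter than `w`. -/
lemma sub_mon_mem_of_slope_lt {w v : ℕ × ℕ} (hv₁ : 0 < v.1) (hv₂ : 0 < v.2)
    (hvw : v.1 * w.2 < w.1 * v.2) {a : ℕ} {g : PS K} (hg : g ∈ ordIdeal K w (wt w (a, 0))) :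
    g - mon K (a, 0) (coef K g (a, 0)) ∈ ordIdeal K v (wt v (a, 0) + 1) := by
  intro p hp
  have hpa : p ≠ (a, 0) := by
    rintro rfl
    simp [coef_sub, coef_mon] at hp
  rw [coef_sub, coef_mon, if_neg hpa, sub_zero] at hp
  have h := hg p hp
  obtain ⟨i, j⟩ := p
  simp only [wt, mul_zero, add_zero] at h ⊢
  rcases lt_or_ge i a with hi | hi
  · obtain ⟨k, rfl⟩ := Nat.exists_eq_add_of_lt hi
    have h1 : w.1 * (k + 1) ≤ w.2 * j := by nlinarith
    have h2 : v.1 * (k + 1) < v.2 * j := by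
      apply Nat.lt_of_mul_lt_mul_left (a := w.2)
      calc w.2 * (v.1 * (k + 1)) = (v.1 * w.2) * (k + 1) := by ring
        _ < (w.1 * v.2) * (k + 1) := Nat.mul_lt_mul_of_pos_right hvw k.succ_pos
        _ = v.2 * (w.1 * (k + 1)) := by ring
        _ ≤ v.2 * (w.2 * j) := Nat.mul_le_mul_left _ h1
        _ = w.2 * (v.2 * j) := by ring
    nlinarith
  · have h1 : v.1 * a ≤ v.1 * i := Nat.mul_le_mul_left _ hi
    rcases hi.eq_or_lt with rfl | hi
    · have hj : 0 < j := Nat.pos_of_ne_zero fun h => hpa (by rw [h])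
      have := Nat.mul_pos hv₂ hj
      omega
    · have : v.1 * a < v.1 * i := Nat.mul_lt_mul_of_pos_left hi hv₁
      omega

section MonomialInitialPart

variable {v : ℕ × ℕ} {a : ℕ} {c : K} {g h : PS K}

lemma isEdge_mul_shift (hc : c ≠ 0) (hg : g - mon K (a, 0) c ∈ ordIdeal K v (wt v (a, 0) + 1))
    {T : NEdge} (hT : IsEdge v h T) : IsEdge v (g * h) (shift a T) := by
  obtain ⟨hA, hB, hw, hh, hface⟩ := hT
  have hmem := mul_mem_ordIdeal (mem_ordIdeal_of_sub_mon_mem hg) hh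
  rw [← wt_add] at hmem
  refine ⟨?_, ?_, ?_, hmem, ?_⟩
  · change coef K (g * h) ((a, 0) + T.A) ≠ 0
    rw [coef_mul_add_of_monomial hg hh rfl]
    exact mul_ne_zero hc hA
  · change coef K (g * h) ((a, 0) + T.B) ≠ 0
    rw [coef_mul_add_of_monomial hg hh hw]
    exact mul_ne_zero hc hB
  · simp only [shift, wt_add, hw]
  · intro p hp hpw
    simp only [shift, wt_add] at hpw
    by_cases hap : (a, 0) ≤ p
    · obtain ⟨q, rfl⟩ := exists_add_of_le hap
      rw [wt_add] at hpw
      have hqw : wt v q = wt v T.A := by omega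
      have hq := hface q (fun h0 => hp (by
        rw [coef_mul_add_of_monomial hg hh hqw, h0, mul_zero])) hqw
      simpa [shift] using hq
    · exact absurd (coef_mul_eq_zero_of_monomial hg hh hpw hap) hp

lemma exists_shift_of_isEdge_mul (hc : c ≠ 0)
    (hg : g - mon K (a, 0) c ∈ ordIdeal K v (wt v (a, 0) + 1)) (hne : (supp K h).Nonempty)
    {S : NEdge} (hS : IsEdge v (g * h) S) : ∃ T, IsEdge v h T ∧ shift a T = S := by
  obtain ⟨hA, hB, hw, hf, hface⟩ := hS
  obtain ⟨p₀, hp₀⟩ := hne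
  obtain ⟨q, hq, hh⟩ := exists_min v hp₀
  have hmem := mul_mem_ordIdeal (mem_ordIdeal_of_sub_mon_mem hg) hh
  have hlevel : wt v S.A = wt v (a, 0) + wt v q := by
    apply le_antisymm _ (hmem _ hA)
    rw [← wt_add]
    apply hf
    rw [coef_mul_add_of_monomial hg hh rfl]
    exact mul_ne_zero hc hq
  have hle : ∀ p ∈ supp K (g * h), wt v p = wt v S.A → (a, 0) ≤ p := by
    intro p hp hpw
    by_contra hap
    exact hp (coef_mul_eq_zero_of_monomial hg hh (hpw.trans hlevel) hap)
  obtain ⟨A', hA'⟩ := exists_add_of_le (hle _ hA rfl)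
  obtain ⟨B', hB'⟩ := exists_add_of_le (hle _ hB hw)
  have hA'w : wt v A' = wt v q := by
    have := hlevel
    rw [hA', wt_add] at this; omega
  have hB'w : wt v B' = wt v q := by
    have := hw.trans hlevel
    rw [hB', wt_add] at this; omega
  have hx := S.hx
  have hy := S.hy
  rw [hA', hB'] at hx hy
  refine ⟨⟨A', B', by simpa using hx, by simpa using hy⟩, ⟨?_, ?_, ?_, ?_, ?_⟩, ?_⟩
  · intro h0
    apply hA
    rw [hA', coef_mul_add_of_monomial hg hh hA'w]
    exact mul_eq_zero_of_right _ h0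
  · intro h0
    apply hB
    rw [hB', coef_mul_add_of_monomial hg hh hB'w]
    exact mul_eq_zero_of_right _ h0
  · exact hB'w.trans hA'w.symm
  · dsimp only; rwa [hA'w]
  · intro p hp hpw
    dsimp only at hpw
    have := hface ((a, 0) + p) (by
      change coef K (g * h) _ ≠ 0
      rw [coef_mul_add_of_monomial hg hh (hpw.trans hA'w)]
      exact mul_ne_zero hc hp) (by rw [hA', wt_add, wt_add, hpw])
    rw [hA', hB'] at this
    simpa using this
  · exact NEdge.eq_of hA'.symm hB'.symm

lemma inBar_mul_shift (hg : g - mon K (a, 0) c ∈ ordIdeal K v (wt v (a, 0) + 1)) {T : NEdge}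
    (hT : IsEdge v h T) :
    inBar K (g * h) (shift a T) = MvPowerSeries.C (σ := Fin 2) (R := K) c * inBar K h T := by
  obtain ⟨-, -, hw, hh, -⟩ := hT
  refine coef_ext fun p => ?_
  rw [coef_C_mul]
  simp only [inBar, coef_ofCoef]
  have e : (p.1 + (shift a T).A.1, p.2 + (shift a T).B.2) =
      (a, 0) + (p.1 + T.A.1, p.2 + T.B.2) := by
    simp [shift, add_left_comm]
  rw [e]
  simp only [shift_mem]
  split_ifs with hmem
  · exact coef_mul_add_of_monomial hg hh (wt_of_mem hw hmem)
  · rw [mul_zero]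

end MonomialInitialPart

lemma IsEdge.mem_of_wt_eq {w : ℕ × ℕ} (hw₂ : 0 < w.2) {f : PS K} {S : NEdge} (hS : IsEdge w f S)
    {p : ℕ × ℕ} (hp : p ∈ supp K f) (hpw : wt w p = wt w S.A) : S.mem p := by
  obtain ⟨-, -, hw, -, hface⟩ := hS
  obtain ⟨h1, h2⟩ := hface p hp hpw
  obtain ⟨⟨a, n⟩, ⟨a', b⟩, hx, hy⟩ := S
  obtain ⟨i, j⟩ := p
  simp only [NEdge.mem, wt, NEdge.len1, NEdge.len2] at *
  dsimp only at hx hy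
  obtain ⟨s, rfl⟩ := Nat.exists_eq_add_of_le h1
  obtain ⟨t, rfl⟩ := Nat.exists_eq_add_of_le h2
  obtain ⟨e, rfl⟩ := Nat.exists_eq_add_of_lt hy
  have hbj : b ≤ j := by
    apply Nat.le_of_mul_le_mul_left _ hw₂
    nlinarith
  have hjn : j ≤ b + e + 1 := by
    apply Nat.le_of_mul_le_mul_left _ hw₂
    nlinarith
  obtain ⟨k, hk⟩ := Nat.exists_eq_add_of_le hjn
  refine ⟨h1, h2, hbj, hjn, ?_⟩
  rw [show a + s - a = s by omega, show b + e + 1 - b = e + 1 by omega,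
    show b + e + 1 - j = k by omega, show a + s + t - a = s + t by omega]
  have h3 : w.1 * (s + t) = w.2 * (e + 1) := by nlinarith
  have h4 : w.1 * s = w.2 * k := by
    rw [hk] at hpw
    nlinarith
  apply Nat.eq_of_mul_eq_mul_left hw₂
  calc w.2 * (s * (e + 1)) = s * (w.2 * (e + 1)) := by ring
    _ = (w.1 * s) * (s + t) := by rw [← h3]; ring
    _ = w.2 * (k * (s + t)) := by rw [h4]; ring

lemma NEdge.mem_A (S : NEdge) : S.mem S.A := by
  have := S.hx.le
  have := S.hy.le
  simp [NEdge.mem, *]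

lemma NEdge.mem_B (S : NEdge) : S.mem S.B := by
  have := S.hx.le
  have := S.hy.le
  simp [NEdge.mem, NEdge.len1, NEdge.len2, *, mul_comm]

section FirstEdge

variable {w : ℕ × ℕ} {f : PS K} {S : NEdge}

lemma coef_inBar (hA : S.A.1 = 0) (p : ℕ × ℕ) : coef K (inBar K f S) p =
    if S.mem ((0, S.B.2) + p) then coef K f ((0, S.B.2) + p) else 0 := by
  simp only [inBar, coef_ofCoef, hA, Prod.add_def, add_comm]

lemma wt_of_add_mem (hS : IsEdge w f S) {p : ℕ × ℕ} (hp : S.mem ((0, S.B.2) + p)) :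
    wt w p = wt w (S.B.1, 0) := by
  have h1 := wt_of_mem hS.2.2.1 hp
  have h2 := hS.2.2.1
  rw [wt_add] at h1
  simp only [wt, mul_zero, zero_add, add_zero] at *
  omega

lemma inBar_mem_ordIdeal (hS : IsEdge w f S) (hA : S.A.1 = 0) :
    inBar K f S ∈ ordIdeal K w (wt w (S.B.1, 0)) := by
  intro p hp
  rw [coef_inBar hA] at hp
  exact (wt_of_add_mem hS (ite_ne_right_iff.1 hp).1).ge

lemma inBar_sub_mon_mem (hA : S.A.1 = 0) :
    inBar K f S - mon K (S.B.1, 0) (coef K f S.B) ∈ ordIdeal K (0, 1) 1 := by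
  intro p hp
  by_contra hlt
  have hp2 : p.2 = 0 := by simpa [wt] using hlt
  apply hp
  rw [coef_sub, coef_mon, coef_inBar hA, sub_eq_zero]
  obtain ⟨i, j⟩ := p
  dsimp only at hp2
  subst hp2
  by_cases hi : i = S.B.1
  · subst hi
    have : ((0, S.B.2) + (S.B.1, 0) : ℕ × ℕ) = S.B := by simp
    rw [this, if_pos S.mem_B, if_pos rfl]
  · have hne : (i, 0) ≠ (S.B.1, 0) := by simpa using hi
    rw [if_neg hne, if_neg]
    intro hmem
    have h5 := hmem.2.2.2.2
    simp only [Prod.add_def, zero_add, add_zero, hA, NEdge.len1, NEdge.len2, Nat.sub_zero] at h5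
    rw [mul_comm] at h5
    exact hi (Nat.eq_of_mul_eq_mul_left (Nat.sub_pos_of_lt S.hy) h5)

lemma sub_inBar_mul_mon_mem (hw₂ : 0 < w.2) (hS : IsEdge w f S) (hA : S.A.1 = 0) :
    f - inBar K f S * mon K (0, S.B.2) 1 ∈ ordIdeal K w (wt w S.B + 1) := by
  intro p hp
  by_contra hlt
  apply hp
  have hmem : coef K f p ≠ 0 → S.mem p := by
    intro h
    have h1 := hS.2.2.2.1 p h
    have h2 := hS.2.2.1
    exact hS.mem_of_wt_eq hw₂ h (by omega)
  rw [coef_sub, sub_eq_zero, mul_comm]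
  by_cases hle : (0, S.B.2) ≤ p
  · obtain ⟨q, rfl⟩ := exists_add_of_le hle
    rw [coef_mon_mul_add, one_mul, coef_inBar hA]
    split_ifs with h
    · rfl
    · exact by_contra fun h' => h (hmem h')
  · rw [coef_mon_mul_of_not_le hle]
    by_contra h
    exact hle ⟨Nat.zero_le _, (hmem h).2.2.1⟩

variable (K) in
/-- `g` is elementary of the same bidegree as `S`, with the initial part of `f` along `S` up to
a monomial and a constant. -/
def IsFactorAt (f : PS K) (S : NEdge) (g : PS K) : Prop :=
  Convenient K g ∧ ordX K g = S.len1 ∧ ordY K g = S.len2 ∧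
    ∃ T : NEdge, newtonPolygon K g = {T} ∧ ∃ c : K, c ≠ 0 ∧
      initialForm K g T = MvPowerSeries.C (σ := Fin 2) (R := K) c * inBar K f S

lemma isFactorAt_of_sub_inBar_mem (hw₁ : 0 < w.1) (hw₂ : 0 < w.2) (hS : IsEdge w f S)
    (hA : S.A.1 = 0) {g : PS K}
    (hg : g - inBar K f S ∈ ordIdeal K w (wt w (S.B.1, 0) + 1)) : IsFactorAt K f S g := by
  have hx := S.hx
  have hy := S.hy
  let T : NEdge := ⟨(0, S.len2), (S.B.1, 0), by dsimp only; omega, Nat.sub_pos_of_lt hy⟩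
  have hTA : ((0, S.B.2) + T.A : ℕ × ℕ) = S.A := by
    apply Prod.ext
    · simp [T, hA]
    · simp only [T, NEdge.len2, Prod.snd_add]; omega
  have hTB : ((0, S.B.2) + T.B : ℕ × ℕ) = S.B := by simp [T]
  have hmem : ∀ p, T.mem p ↔ S.mem ((0, S.B.2) + p) := by
    intro p
    simp only [NEdge.mem, T, Prod.fst_add, Prod.snd_add, NEdge.len1, NEdge.len2, hA, zero_add,
      Nat.sub_zero]
    rw [show S.A.2 - S.B.2 - p.2 = S.A.2 - (S.B.2 + p.2) by omega]
    constructor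
    · rintro ⟨h1, h2, h3, h4, h5⟩
      exact ⟨h1, h2, by omega, by omega, h5⟩
    · rintro ⟨h1, h2, h3, h4, h5⟩
      exact ⟨h1, h2, by omega, by omega, h5⟩
  have hcoef : ∀ p, S.mem ((0, S.B.2) + p) → coef K g p = coef K f ((0, S.B.2) + p) := by
    intro p hp
    have h := wt_of_add_mem hS hp
    rw [coef_congr_of_sub_mem hg (by omega), coef_inBar hA, if_pos hp]
  have hwA := wt_of_add_mem hS ((congrArg S.mem hTA).mpr S.mem_A)
  have hwB := wt_of_add_mem hS ((congrArg S.mem hTB).mpr S.mem_B)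
  have hgm : g ∈ ordIdeal K w (wt w T.A) := by
    have := add_mem (ordIdeal_anti (Nat.le_succ _) hg) (inBar_mem_ordIdeal hS hA)
    rw [sub_add_cancel] at this
    rwa [hwA]
  have hTAs : T.A ∈ supp K g := by
    change coef K g T.A ≠ 0
    rw [hcoef T.A (by rw [hTA]; exact S.mem_A), hTA]
    exact hS.1
  have hTBs : T.B ∈ supp K g := by
    change coef K g T.B ≠ 0
    rw [hcoef T.B (by rw [hTB]; exact S.mem_B), hTB]
    exact hS.2.1
  obtain ⟨h1, h2, h3, h4⟩ := elementary_of_mem_ordIdeal hw₁ hw₂ (T := T) rfl rfl hTAs hTBs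
    (hwB.trans hwA.symm) hgm
  refine ⟨h1, ?_, h3, T, h4, 1, one_ne_zero, ?_⟩
  · rw [h2, NEdge.len1, hA, Nat.sub_zero]
  · refine coef_ext fun p => ?_
    rw [map_one, one_mul, coef_inBar hA]
    simp only [initialForm, coef_ofCoef, hmem]
    split_ifs with h
    · exact hcoef p h
    · rfl

/-- The first edge of the Newton polygon is strictly steeper than all the others. -/
lemma slope_lt_of_isEdge (hw₂ : 0 < w.2) (hS : IsEdge w f S) (hA : S.A.1 = 0)
    {v : ℕ × ℕ} (hv₂ : 0 < v.2) {T : NEdge} (hT : IsEdge v f T) (hne : T ≠ S) :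
    v.1 * w.2 < w.1 * v.2 := by
  rcases lt_trichotomy (v.1 * w.2) (w.1 * v.2) with hlt | heq | hgt
  · exact hlt
  · exfalso
    have hprop : ∀ p, w.2 * wt v p = v.2 * wt w p := by
      intro p
      simp only [wt]
      linear_combination p.1 * heq
    have hvw : ∀ p q, wt v p ≤ wt v q ↔ wt w p ≤ wt w q := by
      intro p q
      rw [← Nat.mul_le_mul_left_iff hw₂, hprop, hprop, Nat.mul_le_mul_left_iff hv₂]
    obtain ⟨hSA, hSB, hSw, hSf, hSface⟩ := hS
    obtain ⟨hTA, hTB, hTw, hTf, hTface⟩ := hT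
    have hAA : wt v T.A = wt v S.A := le_antisymm (hTf _ hSA) ((hvw _ _).2 (hSf _ hTA))
    have hAA' : wt w T.A = wt w S.A := le_antisymm ((hvw _ _).1 hAA.le) (hSf _ hTA)
    have hSw' : wt v S.B = wt v S.A := le_antisymm ((hvw _ _).2 hSw.le) ((hvw _ _).2 hSw.ge)
    have hTw' : wt w T.B = wt w T.A := le_antisymm ((hvw _ _).1 hTw.le) ((hvw _ _).1 hTw.ge)
    have hpt : ∀ p q : ℕ × ℕ, p.1 = q.1 → wt w p = wt w q → p = q := by
      intro p q h1 h2
      refine Prod.ext h1 (Nat.eq_of_mul_eq_mul_left hw₂ ?_)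
      simp only [wt, h1] at h2
      omega
    refine hne (NEdge.eq_of (hpt _ _ ?_ hAA') (hpt _ _ ?_ ?_))
    · exact le_antisymm (hTface _ hSA hAA.symm).1 (hSface _ hTA hAA').1
    · exact le_antisymm (hSface _ hTB (hTw'.trans hAA')).2 (hTface _ hSB (hSw'.trans hAA.symm)).2
    · rw [hTw', hAA', hSw]
  · exfalso
    have h1 := hS.2.2.2.1 _ hT.2.1
    have h2 := hT.2.2.2.1 _ hS.1
    rw [← hT.2.2.1] at h2
    have hpos : 0 < T.B.1 := by have := T.hx; omega
    simp only [wt, hA, mul_zero, zero_add] at h1 h2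
    have h3 : w.2 * (v.1 * T.B.1) ≤ v.2 * (w.1 * T.B.1) := by
      have e1 := Nat.mul_le_mul_left v.2 h1
      have e2 := Nat.mul_le_mul_left w.2 h2
      nlinarith
    have h4 : (w.1 * v.2) * T.B.1 < (v.1 * w.2) * T.B.1 := Nat.mul_lt_mul_of_pos_right hgt hpos
    nlinarith

end FirstEdge

lemma slope_lt_of_isEdge_cofactor {w v : ℕ × ℕ} (hv₂ : 0 < v.2) {b : ℕ} {h : PS K}
    (hh : h - mon K (0, b) 1 ∈ ordIdeal K w (wt w (0, b) + 1)) (hb : (0, b) ∈ supp K h)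
    {T : NEdge} (hT : IsEdge v h T) : v.1 * w.2 < w.1 * v.2 := by
  have hpos : 0 < T.B.1 := by have := T.hx; omega
  have h1 := hh T.B (by
    rw [coef_sub, coef_mon, if_neg, sub_zero]
    · exact hT.2.1
    · intro e
      rw [e] at hpos
      exact lt_irrefl _ hpos)
  have h2 := hT.2.2.2.1 _ hb
  rw [← hT.2.2.1] at h2
  simp only [wt, mul_zero, zero_add] at h1 h2
  apply Nat.lt_of_mul_lt_mul_right (a := T.B.1)
  have e1 := Nat.mul_lt_mul_of_pos_left (Nat.lt_of_succ_le h1) hv₂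
  have e2 := Nat.mul_le_mul_left w.2 h2
  nlinarith

/-- A factorization of `f` over the edges of its Newton polygon. -/
theorem exists_edge_factorization (N : ℕ) {f : PS K} (hconv : Convenient K f)
    (h0 : coef K f (0, 0) = 0) (hN : ∃ n ≤ N, (0, n) ∈ supp K f) :
    (newtonPolygon K f).Finite ∧ ∃ F : NEdge → PS K, f = ∏ᶠ S ∈ newtonPolygon K f, F S ∧
      ∀ S ∈ newtonPolygon K f, IsFactorAt K f S (F S) := by
  induction N using Nat.strong_induction_on generalizing f with
  | _ N ih =>
  obtain ⟨S, hSN, hA⟩ := exists_first_edge hconv h0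
  obtain ⟨w, hw₁, hw₂, hS⟩ := mem_newtonPolygon.1 hSN
  have hsplit := sub_inBar_mul_mon_mem hw₂ hS hA
  rcases Nat.eq_zero_or_pos S.B.2 with hB | hB
  · have e1 : mon K (0, S.B.2) 1 = 1 := by
      rw [hB, mon, expo]
      simp
    have e2 : S.B = (S.B.1, 0) := Prod.ext rfl hB
    rw [e1, mul_one, e2] at hsplit
    have hpoly : newtonPolygon K f = {S} := (elementary_of_mem_ordIdeal hw₁ hw₂ hA hB hS.1 hS.2.1
      hS.2.2.1 hS.2.2.2.1).2.2.2
    rw [hpoly]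
    refine ⟨Set.finite_singleton S, fun _ => f, by simp, ?_⟩
    rintro T rfl
    exact isFactorAt_of_sub_inBar_mem hw₁ hw₂ hS hA hsplit
  · have hapos : 0 < S.B.1 := by have := S.hx; omega
    obtain ⟨g, h, hfgh, hg, hh⟩ := exists_factorization hw₁ hS.2.1 (inBar_mem_ordIdeal hS hA)
      (inBar_sub_mon_mem hA) hsplit
    have hgc : coef K g (S.B.1, 0) ≠ 0 := by
      rw [coef_congr_of_sub_mem hg (Nat.lt_succ_self _), coef_inBar hA]
      have : ((0, S.B.2) + (S.B.1, 0) : ℕ × ℕ) = S.B := by simp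
      rw [this, if_pos S.mem_B]
      exact hS.2.1
    have hgm : g ∈ ordIdeal K w (wt w (S.B.1, 0)) := by
      have := add_mem (ordIdeal_anti (Nat.le_succ _) hg) (inBar_mem_ordIdeal hS hA)
      rwa [sub_add_cancel] at this
    have hb : (0, S.B.2) ∈ supp K h := by
      change coef K h (0, S.B.2) ≠ 0
      rw [coef_congr_of_sub_mem hh (Nat.lt_succ_self _), coef_mon, if_pos rfl]
      exact one_ne_zero
    have hconvh : Convenient K h := by
      refine ⟨?_, S.B.2, hb⟩
      obtain ⟨m, hm⟩ := hconv.1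
      rw [hfgh] at hm
      obtain ⟨q, r, hqr, -, hr⟩ := exists_of_coef_mul_ne_zero hm
      have hr2 : r.2 = 0 := by
        have := congrArg Prod.snd hqr
        simp only [Prod.snd_add] at this
        omega
      exact ⟨r.1, by rw [← hr2]; exact hr⟩
    have h00 : coef K h (0, 0) = 0 := by
      apply coef_eq_zero_of_mem (mem_ordIdeal_of_sub_mon_mem hh)
      simpa [wt] using ⟨hw₂, hB⟩
    have hlt : S.B.2 < N := by
      obtain ⟨n, hn, hns⟩ := hN
      have h1 := hS.2.2.2.1 _ hns
      simp only [wt, hA, mul_zero, zero_add] at h1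
      have h2 := Nat.le_of_mul_le_mul_left h1 hw₂
      have := S.hy
      omega
    obtain ⟨hfin, F, hF, hFS⟩ := ih _ hlt hconvh h00 ⟨_, le_rfl, hb⟩
    have hg_initial : ∀ v : ℕ × ℕ, 0 < v.1 → 0 < v.2 → ∀ T, IsEdge v h T →
        g - mon K (S.B.1, 0) (coef K g (S.B.1, 0)) ∈ ordIdeal K v (wt v (S.B.1, 0) + 1) :=
      fun v hv₁ hv₂ T hT => sub_mon_mem_of_slope_lt hv₁ hv₂
        (slope_lt_of_isEdge_cofactor hv₂ hh hb hT) hgm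
    have hpoly : newtonPolygon K f = insert S (Set.image (shift S.B.1) (newtonPolygon K h)) := by
      ext T
      rw [Set.mem_insert_iff]
      constructor
      · intro hT
        refine or_iff_not_imp_left.2 fun hne => ?_
        obtain ⟨v, hv₁, hv₂, hTv⟩ := mem_newtonPolygon.1 hT
        have hlt := slope_lt_of_isEdge hw₂ hS hA hv₂ hTv hne
        rw [hfgh] at hTv
        obtain ⟨T', hT', rfl⟩ := exists_shift_of_isEdge_mul hgc
          (sub_mon_mem_of_slope_lt hv₁ hv₂ hlt hgm) ⟨_, hb⟩ hTv
        exact ⟨T', mem_newtonPolygon.2 ⟨v, hv₁, hv₂, hT'⟩, rfl⟩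
      · rintro (rfl | ⟨T', hT', rfl⟩)
        · exact hSN
        · obtain ⟨v, hv₁, hv₂, hTv⟩ := mem_newtonPolygon.1 hT'
          refine mem_newtonPolygon.2 ⟨v, hv₁, hv₂, ?_⟩
          rw [hfgh]
          exact isEdge_mul_shift hgc (hg_initial v hv₁ hv₂ T' hTv) hTv
    have hSshift : ∀ T, shift S.B.1 T ≠ S := by
      intro T e
      have := congrArg (fun U : NEdge => U.A.1) e
      simp only [shift, Prod.fst_add, hA] at this
      omega
    have hSnot : S ∉ Set.image (shift S.B.1) (newtonPolygon K h) := fun ⟨T, _, hT⟩ => hSshift T hT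
    let F' : NEdge → PS K := Function.extend (shift S.B.1) F fun _ => g
    have hF'S : F' S = g := Function.extend_apply' _ _ _ fun ⟨T, hT⟩ => hSshift T hT
    have hF' : ∀ T, F' (shift S.B.1 T) = F T :=
      fun T => (shift_injective _).extend_apply _ _ _
    refine ⟨hpoly ▸ (hfin.image _).insert S, F', ?_, ?_⟩
    · rw [hpoly, finprod_mem_insert _ hSnot (hfin.image _),
        finprod_mem_image (shift_injective _).injOn, hF'S]
      simp only [hF']
      rw [← hF]
      exact hfgh
    · rw [hpoly]
      rintro _ (rfl | ⟨T, hT, rfl⟩)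
      · rw [hF'S]
        exact isFactorAt_of_sub_inBar_mem hw₁ hw₂ hS hA hg
      · rw [hF']
        obtain ⟨hc1, hc2, hc3, U, hU, c, hc, hin⟩ := hFS T hT
        obtain ⟨v, hv₁, hv₂, hTv⟩ := mem_newtonPolygon.1 hT
        refine ⟨hc1, by rw [hc2, shift_len1], by rw [hc3, shift_len2], U, hU,
          c * (coef K g (S.B.1, 0))⁻¹, mul_ne_zero hc (inv_ne_zero hgc), ?_⟩
        rw [hin, hfgh, inBar_mul_shift (hg_initial v hv₁ hv₂ T hTv) hTv, ← mul_assoc, ← map_mul,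
          inv_mul_cancel_right₀ hgc]

theorem newton_factorization (K : Type u) [Field K] [IsAlgClosed K]
    (f : PS K) (hconv : Convenient K f)
    (h0 : MvPowerSeries.constantCoeff f = 0) :
    ∃ F : NEdge → PS K, f = ∏ᶠ S ∈ newtonPolygon K f, F S ∧
      ∀ S ∈ newtonPolygon K f,
        Convenient K (F S) ∧ ordX K (F S) = S.len1 ∧ ordY K (F S) = S.len2 ∧
          ∃ T : NEdge, newtonPolygon K (F S) = {T} ∧
            ∃ c : K, c ≠ 0 ∧
              initialForm K (F S) T = MvPowerSeries.C (σ := Fin 2) (R := K) c * inBar K f S := by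
  obtain ⟨n, hn⟩ := hconv.2
  rw [constantCoeff_eq_coef] at h0
  exact (exists_edge_factorization n hconv h0 ⟨n, le_rfl, hn⟩).2

end PlaneCurveNote
end
end

section
/- Let K be an algebraically closed field. If f ∈ K[[x,y]] is convenient and non-degenerate, and f = ∏_{S ∈ N_f} f_S is its Newton factorization into elementary power series, then each factor f_S is non-degenerate. -/
/-!
Common definitions for formalizing "A note on the plane curve singularities in
positive characteristic" by E. García Barroso and A. Płoski.

We work with the ring `K[[x,y]] := MvPowerSeries (Fin 2) K`, where `x` is the
variable of index `0` and `y` the variable of index `1`.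
-/

open scoped Classical

noncomputable section

universe u

namespace PlaneCurveNote

variable (K : Type u) [Field K]

/-- The initial form factors as a monomial times `ī(f,S)`; in particular `ī(f,S)` divides it. -/
theorem inBar_dvd_initialForm (K : Type u) [Field K] (f : PS K) (S : NEdge) :
    inBar K f S ∣ initialForm K f S := by
  refine ⟨MvPowerSeries.monomial (Finsupp.single 0 S.A.1 + Finsupp.single 1 S.B.2) 1, ?_⟩
  ext d
  rw [MvPowerSeries.coeff_mul_monomial, mul_one]
  change (if S.mem (d 0, d 1) then coef K f (d 0, d 1) else 0) = _
  split_ifs with hmem hle hle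
  · have h0 : d 0 - S.A.1 + S.A.1 = d 0 := Nat.sub_add_cancel hmem.1
    have h1 : d 1 - S.B.2 + S.B.2 = d 1 := Nat.sub_add_cancel hmem.2.2.1
    simp [MvPowerSeries.coeff_apply, inBar, ofCoef, h0, h1, hmem]
  · refine absurd (fun i => ?_) hle
    fin_cases i
    · simpa using hmem.1
    · simpa using hmem.2.2.1
  · have h0 : d 0 - S.A.1 + S.A.1 = d 0 := Nat.sub_add_cancel (by simpa using hle 0)
    have h1 : d 1 - S.B.2 + S.B.2 = d 1 := Nat.sub_add_cancel (by simpa using hle 1)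
    simp [MvPowerSeries.coeff_apply, inBar, ofCoef, h0, h1, hmem]
  · rfl

theorem newton_factor_nondegenerate (K : Type u) [Field K] [IsAlgClosed K]
    (f : PS K) (hconv : Convenient K f) (hnd : NonDegenerate K f)
    (F : NEdge → PS K) (hfac : f = ∏ᶠ S ∈ newtonPolygon K f, F S)
    (helem : ∀ S ∈ newtonPolygon K f,
      Convenient K (F S) ∧ ordX K (F S) = S.len1 ∧ ordY K (F S) = S.len2 ∧
        ∃ T : NEdge, newtonPolygon K (F S) = {T} ∧
          ∃ c : K, c ≠ 0 ∧
            initialForm K (F S) T = MvPowerSeries.C c * inBar K f S) :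
    ∀ S ∈ newtonPolygon K f, NonDegenerate K (F S) := by
  intro S hS T' hT'
  obtain ⟨-, -, -, T, hT, c, hc, hin⟩ := helem S hS
  obtain rfl : T' = T := by simpa [hT] using hT'
  have hunit : IsUnit (MvPowerSeries.C c : PS K) := hc.isUnit.map MvPowerSeries.C
  have hdvd : inBar K (F S) T' ∣ inBar K f S :=
    hunit.dvd_mul_left.mp (hin ▸ inBar_dvd_initialForm K (F S) T')
  exact (hnd S hS).squarefree_of_dvd hdvd

end PlaneCurveNote
end
end
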